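/- Let G1 and G2 be nontrivial finite groups and F = G1 ∗ G2 their free product, and let H1 be a finitely generated factor-free noncyclic subgroup of F. Then the WN-coefficient σ(H1) = sup { r̄(H1, H2) / (r̄(H1)·r̄(H2)) : H2 a finitely generated factor-free noncyclic subgroup of F } is a finite rational number. -/

import Mathlib

open Monoid

section Defs

variable {F : Type} [Group F]

/-- The conjugate subgroup `t K t⁻¹`. -/
def conjS (t : F) (K : Subgroup F) : Subgroup F := K.map (MulAut.conj t).toMonoidHom

/-- The rank of a subgroup: the minimal number of generators. -/
noncomputable def rk (H : Subgroup F) : ℕ :=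
  sInf {n : ℕ | ∃ S : Finset F, S.card = n ∧ Subgroup.closure (S : Set F) = H}

/-- The reduced rank `r̄(H) = max(r(H) - 1, 0)`. -/
noncomputable def rrk (H : Subgroup F) : ℕ := rk H - 1

/-- The setoid on `F` whose classes are the double cosets `H s K`. -/
def dcSetoid (H K : Subgroup F) : Setoid F where
  r s t := ∃ h ∈ H, ∃ k ∈ K, h * s * k = t
  iseqv := by
    refine ⟨fun s => ⟨1, H.one_mem, 1, K.one_mem, by group⟩, ?_, ?_⟩
    · rintro s t ⟨h, hh, k, hk, rfl⟩
      exact ⟨h⁻¹, H.inv_mem hh, k⁻¹, K.inv_mem hk, by group⟩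
    · rintro s t u ⟨h, hh, k, hk, rfl⟩ ⟨h', hh', k', hk', rfl⟩
      exact ⟨h' * h, H.mul_mem hh' hh, k * k', K.mul_mem hk hk', by group⟩

/-- The reduced rank of the generalized intersection of `H` and `K`:
the sum, over the double cosets `H s K`, of `r̄(H ∩ s K s⁻¹)`
(the summands corresponding to trivial intersections vanish, so this agrees with
the sum over the double cosets with nontrivial intersection). -/
noncomputable def rrkInter (H K : Subgroup F) : ℕ :=
  finsum fun q : Quotient (dcSetoid H K) => rrk (H ⊓ conjS q.out K)

/-- `H` is not a cyclic subgroup. -/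
def Noncyclic (H : Subgroup F) : Prop := ∀ g : F, H ≠ Subgroup.closure {g}

end Defs

section TwoFactors

variable {G1 G2 : Type} [Group G1] [Group G2]

/-- A subgroup of `G1 ∗ G2` is factor-free if it meets every conjugate of each of
the two factors trivially. -/
def FactorFree2 (H : Subgroup (Coprod G1 G2)) : Prop :=
  ∀ s : Coprod G1 G2,
    H ⊓ conjS s (Coprod.inl : G1 →* Coprod G1 G2).range = ⊥ ∧
    H ⊓ conjS s (Coprod.inr : G2 →* Coprod G1 G2).range = ⊥

/-- The set of ratios `r̄(H1, H2) / (r̄(H1)·r̄(H2))` over all finitely generated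
factor-free noncyclic subgroups `H2`; its supremum is the WN-coefficient `σ(H1)`. -/
noncomputable def wnSet (H1 : Subgroup (Coprod G1 G2)) : Set ℝ :=
  {x | ∃ H2 : Subgroup (Coprod G1 G2), H2.FG ∧ FactorFree2 H2 ∧ Noncyclic H2 ∧
    x = (rrkInter H1 H2 : ℝ) / ((rrk H1 : ℝ) * (rrk H2 : ℝ))}

end TwoFactors

section EulerCharacteristic

open scoped Classical

variable {F G G' : Type} [Group F] [Group G] [Group G'] (j : G →* F) (j' : G' →* F)
  {X : Type} [MulAction F X]

/-- The orbit of `x` under the group `G` acting through `j : G →* F`. -/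
def orb (x : X) : Set X := Set.range fun g : G => j g • x

variable {j} in
theorem orb_eq_iff {x y : X} : orb j x = orb j y ↔ ∃ g, j g • x = y := by
  constructor
  · intro h
    have : y ∈ orb j y := ⟨1, by simp⟩
    rw [← h] at this
    exact this
  · rintro ⟨g, rfl⟩
    ext z
    constructor
    · rintro ⟨k, rfl⟩
      exact ⟨k * g⁻¹, by simp [mul_smul]⟩
    · rintro ⟨k, rfl⟩
      exact ⟨k * g, by simp [mul_smul]⟩

/-- The number of `G`-orbits meeting the finite set `Z`. -/
noncomputable def orbCount (Z : Finset X) : ℕ := (Z.image (orb j)).card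

/-- The negated Euler characteristic of the bipartite graph whose edges are the elements of `Z`
and whose vertices are the orbits of `G` and `G'` meeting `Z`. -/
noncomputable def negEuler (Z : Finset X) : ℤ := Z.card - orbCount j Z - orbCount j' Z

/-- `G` acts freely on `X` through `j`. -/
def ActsFreely (j : G →* F) (X : Type) [MulAction F X] : Prop :=
  ∀ (g : G) (x : X), j g • x = x → g = 1

theorem negEuler_comm (Z : Finset X) : negEuler j j' Z = negEuler j' j Z := by
  unfold negEuler; ring

@[simp] theorem negEuler_empty : negEuler j j' (∅ : Finset X) = 0 := by
  simp [negEuler, orbCount]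

theorem negEuler_le_card (Z : Finset X) : negEuler j j' Z ≤ Z.card := by
  unfold negEuler; lia

variable {j j'}

theorem orbCount_union {Z Z' : Finset X}
    (h : ∀ z ∈ Z, ∀ z' ∈ Z', ∀ g, j g • z ≠ z') :
    orbCount j (Z ∪ Z') = orbCount j Z + orbCount j Z' := by
  unfold orbCount
  rw [Finset.image_union, Finset.card_union_of_disjoint]
  rw [Finset.disjoint_left]
  intro o ho ho'
  obtain ⟨z, hz, rfl⟩ := Finset.mem_image.1 ho
  obtain ⟨z', hz', hzz⟩ := Finset.mem_image.1 ho'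
  obtain ⟨g, hg⟩ := orb_eq_iff.1 hzz.symm
  exact h z hz z' hz' g hg

theorem negEuler_union {Z Z' : Finset X}
    (h : ∀ z ∈ Z, ∀ z' ∈ Z', ∀ g, j g • z ≠ z')
    (h' : ∀ z ∈ Z, ∀ z' ∈ Z', ∀ g, j' g • z ≠ z') :
    negEuler j j' (Z ∪ Z') = negEuler j j' Z + negEuler j j' Z' := by
  have hd : Disjoint Z Z' := by
    rw [Finset.disjoint_left]
    exact fun z hz hz' => h z hz z hz' 1 (by simp)
  unfold negEuler
  rw [orbCount_union h, orbCount_union h', Finset.card_union_of_disjoint hd]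
  push_cast; ring

theorem orbCount_image {W : Type} [MulAction F W] {Z : Finset X} {φ : X → W}
    (h : ∀ z ∈ Z, ∀ z' ∈ Z, ∀ g, j g • z = z' ↔ j g • φ z = φ z') :
    orbCount j (Z.image φ) = orbCount j Z := by
  unfold orbCount
  rw [Finset.image_image]
  have key : ∀ z ∈ Z, ∀ z' ∈ Z, orb j (φ z) = orb j (φ z') ↔ orb j z = orb j z' := by
    intro z hz z' hz'
    rw [orb_eq_iff, orb_eq_iff]
    exact exists_congr fun g => (h z hz z' hz' g).symm
  symm
  refine Finset.card_bij (fun o _ =>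
    if ho : ∃ z ∈ Z, orb j z = o then orb j (φ ho.choose) else ∅) ?_ ?_ ?_
  · intro o ho
    have ho := Finset.mem_image.1 ho
    simp only [dif_pos ho]
    exact Finset.mem_image.2 ⟨_, ho.choose_spec.1, rfl⟩
  · intro o ho o' ho' e
    have ho := Finset.mem_image.1 ho
    have ho' := Finset.mem_image.1 ho'
    simp only [dif_pos ho, dif_pos ho'] at e
    rw [← ho.choose_spec.2, ← ho'.choose_spec.2]
    exact (key _ ho.choose_spec.1 _ ho'.choose_spec.1).1 e
  · intro o ho
    obtain ⟨z, hz, rfl⟩ := Finset.mem_image.1 ho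
    have hz2 : ∃ w ∈ Z, orb j w = orb j z := ⟨z, hz, rfl⟩
    refine ⟨orb j z, Finset.mem_image.2 ⟨z, hz, rfl⟩, ?_⟩
    simp only [dif_pos hz2]
    exact (key _ hz2.choose_spec.1 _ hz).2 hz2.choose_spec.2

theorem negEuler_image {W : Type} [MulAction F W] {Z : Finset X} {φ : X → W}
    (h : ∀ z ∈ Z, ∀ z' ∈ Z, ∀ g, j g • z = z' ↔ j g • φ z = φ z')
    (h' : ∀ z ∈ Z, ∀ z' ∈ Z, ∀ g, j' g • z = z' ↔ j' g • φ z = φ z') :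
    negEuler j j' (Z.image φ) = negEuler j j' Z := by
  unfold negEuler
  rw [orbCount_image h, orbCount_image h', Finset.card_image_of_injOn]
  intro z hz z' hz' e
  simpa using (h z hz z' hz' 1).2 (by simpa using e)

theorem negEuler_eq_sum_fibers {Q : Type} (π : X → Q) (hπ : ∀ (f : F) x, π (f • x) = π x)
    (Z : Finset X) (Q₀ : Finset Q) (hQ : ∀ z ∈ Z, π z ∈ Q₀) :
    negEuler j j' Z = ∑ q ∈ Q₀, negEuler j j' (Z.filter (π · = q)) := by
  induction Q₀ using Finset.induction_on generalizing Z with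
  | empty =>
    have : Z = ∅ := Finset.eq_empty_of_forall_notMem fun z hz => by simpa using hQ z hz
    simp [this]
  | insert q Q₀ hq ih =>
    have e : Z = Z.filter (π · = q) ∪ Z.filter (π · ≠ q) :=
      (Finset.filter_union_filter_not_eq _ _).symm
    have sep : ∀ z ∈ Z.filter (π · = q), ∀ z' ∈ Z.filter (π · ≠ q), ∀ f : F, f • z ≠ z' := by
      intro z hz z' hz' f hf
      have h1 := (Finset.mem_filter.1 hz).2
      have h2 := (Finset.mem_filter.1 hz').2
      rw [← hf, hπ] at h2
      exact h2 h1
    conv_lhs => rw [e]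
    rw [negEuler_union (fun z hz z' hz' g => sep z hz z' hz' _)
      (fun z hz z' hz' g => sep z hz z' hz' _), Finset.sum_insert hq]
    congr 1
    rw [ih]
    · refine Finset.sum_congr rfl fun p hp => ?_
      congr 1
      ext z
      simp only [Finset.mem_filter]
      constructor
      · rintro ⟨⟨h1, -⟩, h2⟩; exact ⟨h1, h2⟩
      · rintro ⟨h1, h2⟩
        refine ⟨⟨h1, ?_⟩, h2⟩
        rintro h3
        exact hq (by rw [← h3, h2]; exact hp)
    · intro z hz
      have h1 := Finset.mem_filter.1 hz
      exact (Finset.mem_insert.1 (hQ z h1.1)).resolve_left h1.2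

/-- Removing edges that end in leaves does not decrease the negated Euler characteristic. -/
theorem negEuler_le_sdiff {Z P : Finset X} (hP : P ⊆ Z)
    (leaf : ∀ p ∈ P, ∀ g, j' g • p ∈ Z → j' g • p = p) :
    negEuler j j' Z ≤ negEuler j j' (Z \ P) := by
  have h1 : orbCount j (Z \ P) ≤ orbCount j Z :=
    Finset.card_le_card (Finset.image_subset_image Finset.sdiff_subset)
  have h2 : orbCount j' Z = orbCount j' (Z \ P) + orbCount j' P := by
    rw [← orbCount_union, Finset.sdiff_union_of_subset hP]
    intro z hz p hp g hg
    have e : j' g⁻¹ • p = z := by rw [← hg]; simp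
    have := leaf p hp g⁻¹ (by rw [e]; exact (Finset.mem_sdiff.1 hz).1)
    rw [e] at this
    exact (Finset.mem_sdiff.1 hz).2 (this ▸ hp)
  have h3 : orbCount j' P = P.card := by
    refine Finset.card_image_of_injOn ?_
    intro p hp q hq e
    obtain ⟨g, rfl⟩ := orb_eq_iff.1 e
    exact (leaf p hp g (hP hq)).symm
  have h4 := Finset.card_sdiff_add_card_eq_card hP
  unfold negEuler
  lia

theorem orbCount_eq_sum [Fintype G] (hX : ActsFreely j X) (Z : Finset X) :
    (orbCount j Z : ℚ) = ∑ z ∈ Z, 1 / ((Finset.univ.filter fun g : G => j g • z ∈ Z).card : ℚ) := by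
  rw [← Finset.sum_fiberwise_of_maps_to (g := orb j) (t := Z.image (orb j))
    (fun z hz => Finset.mem_image_of_mem _ hz)]
  have key : ∀ o ∈ Z.image (orb j), ∑ z ∈ Z with orb j z = o,
      1 / ((Finset.univ.filter fun g : G => j g • z ∈ Z).card : ℚ) = 1 := by
    intro o ho
    have hz : ∀ z ∈ Z.filter (orb j · = o),
        (Finset.univ.filter fun g : G => j g • z ∈ Z).card = (Z.filter (orb j · = o)).card := by
      intro z hz
      obtain ⟨hz, rfl⟩ := Finset.mem_filter.1 hz
      refine Finset.card_bij (fun g _ => j g • z) ?_ ?_ ?_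
      · intro g hg
        exact Finset.mem_filter.2 ⟨(Finset.mem_filter.1 hg).2,
          (orb_eq_iff.2 ⟨g, rfl⟩).symm⟩
      · intro g _ k _ e
        have : j (k⁻¹ * g) • z = z := by
          rw [map_mul, mul_smul, e]; simp
        exact (inv_mul_eq_one.1 (hX _ _ this)).symm
      · intro y hy
        obtain ⟨hy, e⟩ := Finset.mem_filter.1 hy
        obtain ⟨g, rfl⟩ := orb_eq_iff.1 e.symm
        exact ⟨g, by simpa using hy, rfl⟩
    rw [Finset.sum_congr rfl (fun z h => by rw [hz z h]), Finset.sum_const, nsmul_eq_mul,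
      mul_one_div_cancel]
    obtain ⟨z, hzZ, rfl⟩ := Finset.mem_image.1 ho
    exact_mod_cast (Finset.card_pos.2 ⟨z, by simp [hzZ]⟩).ne'
  rw [Finset.sum_congr rfl key]
  simp [orbCount]

end EulerCharacteristic

section LowerBound

open scoped Classical

variable {G1 G2 : Type} [Group G1] [Group G2] {X : Type} [MulAction (Coprod G1 G2) X]

/-- An auxiliary action of `G1 ∗ G2` on `X × (X →₀ ℚ)`, in which `G1` acts with the coboundary of
the tautological cochain and `G2` acts trivially on the second coordinate. -/
noncomputable def cocycleAction (X : Type) [MulAction (Coprod G1 G2) X] :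
    Coprod G1 G2 →* Function.End (X × (X →₀ ℚ)) :=
  Coprod.lift
    { toFun := fun g p => ((Coprod.inl g : Coprod G1 G2) • p.1,
        p.2 + (Finsupp.single ((Coprod.inl g : Coprod G1 G2) • p.1) 1 - Finsupp.single p.1 1))
      map_one' := by
        funext p
        change _ = p
        simp
      map_mul' := by
        intro g h
        funext p
        change _ = (((Coprod.inl g : Coprod G1 G2) • (Coprod.inl h : Coprod G1 G2) • p.1,
          p.2 + _ + _) : X × (X →₀ ℚ))
        simp only [map_mul, mul_smul]
        congr 1
        abel }
    { toFun := fun g p => ((Coprod.inr g : Coprod G1 G2) • p.1, p.2)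
      map_one' := by
        funext p
        change _ = p
        simp
      map_mul' := by
        intro g h
        funext p
        change _ = (((Coprod.inr g : Coprod G1 G2) • (Coprod.inr h : Coprod G1 G2) • p.1,
          p.2) : X × (X →₀ ℚ))
        simp only [map_mul, mul_smul] }

theorem cocycleAction_inl (g : G1) (p : X × (X →₀ ℚ)) :
    cocycleAction X (Coprod.inl g : Coprod G1 G2) p = ((Coprod.inl g : Coprod G1 G2) • p.1,
      p.2 + (Finsupp.single ((Coprod.inl g : Coprod G1 G2) • p.1) 1 - Finsupp.single p.1 1)) := by
  rw [cocycleAction, Coprod.lift_apply_inl]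
  rfl

theorem cocycleAction_inr (g : G2) (p : X × (X →₀ ℚ)) :
    cocycleAction X (Coprod.inr g : Coprod G1 G2) p
      = ((Coprod.inr g : Coprod G1 G2) • p.1, p.2) := by
  rw [cocycleAction, Coprod.lift_apply_inr]
  rfl

/-- The cocycle of the auxiliary action. -/
noncomputable def cocycle (f : Coprod G1 G2) (x : X) : X →₀ ℚ := (cocycleAction X f (x, 0)).2

theorem cocycleAction_apply (f : Coprod G1 G2) (x : X) (m : X →₀ ℚ) :
    cocycleAction X f (x, m) = (f • x, m + cocycle f x) := by
  induction f using Coprod.induction_on generalizing x m with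
  | inl g => simp [cocycle, cocycleAction_inl]
  | inr g => simp [cocycle, cocycleAction_inr]
  | mul f f' ih ih' =>
    have e : ∀ m, cocycleAction X (f * f') (x, m) = cocycleAction X f (cocycleAction X f' (x, m)) :=
      fun m => by rw [map_mul]; rfl
    unfold cocycle
    rw [e, e, ih', ih, ih', ih, mul_smul]
    simp [add_assoc]

theorem cocycle_mul (f f' : Coprod G1 G2) (x : X) :
    cocycle (f * f') x = cocycle f' x + cocycle f (f' • x) := by
  have e : cocycleAction X (f * f') (x, 0) = cocycleAction X f (cocycleAction X f' (x, 0)) := by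
    rw [map_mul]; rfl
  rw [cocycleAction_apply, cocycleAction_apply, cocycleAction_apply] at e
  simpa using congrArg Prod.snd e

theorem cocycle_one (x : X) : cocycle (1 : Coprod G1 G2) x = 0 := by
  have := cocycle_mul (1 : Coprod G1 G2) 1 x
  simpa using this

theorem cocycle_inl (g : G1) (x : X) : cocycle (Coprod.inl g : Coprod G1 G2) x =
    Finsupp.single ((Coprod.inl g : Coprod G1 G2) • x) 1 - Finsupp.single x 1 := by
  simp [cocycle, cocycleAction_inl]

theorem cocycle_inr (g : G2) (x : X) : cocycle (Coprod.inr g : Coprod G1 G2) x = 0 := by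
  simp [cocycle, cocycleAction_inr]

/-- A cochain whose periods along generators of a point stabilizer vanish is a sum of functions
invariant under the two factors. -/
theorem exists_invariant_sub [MulAction.IsPretransitive (Coprod G1 G2) X] (x₀ : X)
    (S : Set (Coprod G1 G2)) (hS : Subgroup.closure S = MulAction.stabilizer (Coprod G1 G2) x₀)
    (c : (X →₀ ℚ) →ₗ[ℚ] ℚ) (hc : ∀ s ∈ S, c (cocycle s x₀) = 0) :
    ∃ b : X → ℚ, (∀ (g : G2) x, b ((Coprod.inr g : Coprod G1 G2) • x) = b x) ∧
      ∀ (g : G1) x, b ((Coprod.inl g : Coprod G1 G2) • x)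
        - c (Finsupp.single ((Coprod.inl g : Coprod G1 G2) • x) 1)
          = b x - c (Finsupp.single x 1) := by
  have hH : ∀ h ∈ MulAction.stabilizer (Coprod G1 G2) x₀, c (cocycle h x₀) = 0 := by
    intro h hh
    have key : ∀ h ∈ Subgroup.closure S, h • x₀ = x₀ ∧ c (cocycle h x₀) = 0 := by
      intro h hh
      refine ⟨by rw [hS] at hh; exact hh, ?_⟩
      induction hh using Subgroup.closure_induction with
      | mem s hs => exact hc s hs
      | one => simp [cocycle_one]
      | mul x y hx hy ihx ihy =>
        have : y • x₀ = x₀ := by rw [hS] at hy; exact hy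
        rw [cocycle_mul, this, map_add, ihx, ihy, add_zero]
      | inv x hx ih =>
        have hx' : x • x₀ = x₀ := by rw [hS] at hx; exact hx
        have := cocycle_mul x⁻¹ x x₀
        rw [inv_mul_cancel, cocycle_one, hx'] at this
        have h2 := congrArg c this
        rw [map_add, ih] at h2
        simpa using h2.symm
    exact (key h (hS ▸ hh)).2
  choose p hp using fun x : X => MulAction.exists_smul_eq (Coprod G1 G2) x₀ x
  have hwd : ∀ (f : Coprod G1 G2) x, c (cocycle (p (f • x)) x₀) =
      c (cocycle (p x) x₀) + c (cocycle f x) := by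
    intro f x
    have h1 : (p (f • x))⁻¹ * (f * p x) ∈ MulAction.stabilizer (Coprod G1 G2) x₀ := by
      rw [MulAction.mem_stabilizer_iff, mul_smul, mul_smul, hp, inv_smul_eq_iff, hp]
    have h2 := cocycle_mul (p (f • x)) ((p (f • x))⁻¹ * (f * p x)) x₀
    rw [mul_inv_cancel_left, MulAction.mem_stabilizer_iff.1 h1, cocycle_mul, hp] at h2
    have h3 := congrArg c h2
    rw [map_add, map_add, hH _ h1] at h3
    linarith
  refine ⟨fun x => c (cocycle (p x) x₀), fun g x => ?_, fun g x => ?_⟩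
  · simp only [hwd, cocycle_inr, map_zero, add_zero]
  · simp only [hwd, cocycle_inl, map_sub]
    ring

/-- Extension by zero of a cochain on a finite set. -/
noncomputable def extendCochain (Z : Finset X) : (Z → ℚ) →ₗ[ℚ] (X →₀ ℚ) →ₗ[ℚ] ℚ where
  toFun c := Finsupp.linearCombination ℚ (fun x => if h : x ∈ Z then c ⟨x, h⟩ else 0)
  map_add' c d := by
    ext x
    by_cases h : x ∈ Z <;> simp [h]
  map_smul' r c := by
    ext x
    by_cases h : x ∈ Z <;> simp [h]

theorem extendCochain_single {Z : Finset X} (c : Z → ℚ) (z : Z) :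
    extendCochain Z c (Finsupp.single z.1 1) = c z := by
  simp [extendCochain]

/-- The negated Euler characteristic of a nonempty finite subgraph is bounded by the number of
generators of a point stabilizer. -/
theorem one_add_negEuler_le [MulAction.IsPretransitive (Coprod G1 G2) X] (x₀ : X)
    (S : Finset (Coprod G1 G2))
    (hS : Subgroup.closure (S : Set (Coprod G1 G2)) = MulAction.stabilizer (Coprod G1 G2) x₀)
    (Z : Finset X) (hZ : Z.Nonempty) :
    1 + negEuler (Coprod.inl : G1 →* Coprod G1 G2) Coprod.inr Z ≤ S.card := by
  let A := Z.image (orb (Coprod.inl : G1 →* Coprod G1 G2))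
  let B := Z.image (orb (Coprod.inr : G2 →* Coprod G1 G2))
  let ext := extendCochain Z
  have ext_single : ∀ c (z : Z), ext c (Finsupp.single z.1 1) = c z := extendCochain_single
  clear_value ext
  let Φ : (Z → ℚ) →ₗ[ℚ] (S → ℚ) :=
    { toFun := fun c s => ext c (cocycle s.1 x₀)
      map_add' := by intro c d; funext s; simp
      map_smul' := by intro r c; funext s; simp }
  let Ψ : ((A → ℚ) × (B → ℚ)) →ₗ[ℚ] (Z → ℚ) :=
    { toFun := fun ab z => ab.1 ⟨orb _ z.1, Finset.mem_image_of_mem _ z.2⟩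
        + ab.2 ⟨orb _ z.1, Finset.mem_image_of_mem _ z.2⟩
      map_add' := by intro c d; funext s; simp; ring
      map_smul' := by intro r c; funext s; simp; ring }
  have hker : LinearMap.ker Φ ≤ LinearMap.range Ψ := by
    intro c hc
    have hc' : Φ c = 0 := LinearMap.mem_ker.1 hc
    have hc₀ : ∀ s ∈ (S : Set (Coprod G1 G2)), ext c (cocycle s x₀) = 0 := by
      intro s hs
      have := congrFun hc' ⟨s, Finset.mem_coe.1 hs⟩
      simpa only [Φ, LinearMap.coe_mk, AddHom.coe_mk, Pi.zero_apply] using this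
    obtain ⟨b, hb, ha⟩ := exists_invariant_sub x₀ (S : Set (Coprod G1 G2)) hS (ext c) hc₀
    choose zA hzA using fun a : A => Finset.mem_image.1 a.2
    choose zB hzB using fun a : B => Finset.mem_image.1 a.2
    refine ⟨⟨fun a => -(b (zA a) - ext c (Finsupp.single (zA a) 1)), fun a => b (zB a)⟩, ?_⟩
    funext z
    let oA : A := ⟨orb _ z.1, Finset.mem_image_of_mem _ z.2⟩
    let oB : B := ⟨orb _ z.1, Finset.mem_image_of_mem _ z.2⟩
    obtain ⟨g, hg⟩ := orb_eq_iff.1 (hzA oA).2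
    obtain ⟨g', hg'⟩ := orb_eq_iff.1 (hzB oB).2
    have h1 := ha g (zA oA)
    have h2 := hb g' (zB oB)
    rw [hg, ext_single c z] at h1
    rw [hg'] at h2
    change -(b (zA oA) - ext c (Finsupp.single (zA oA) 1)) + b (zB oB) = c z
    rw [← h1, ← h2]
    ring
  have hΨ : 0 < Module.finrank ℚ (LinearMap.ker Ψ) := by
    rw [Module.finrank_pos_iff_exists_ne_zero]
    refine ⟨⟨⟨fun _ => 1, fun _ => -1⟩, ?_⟩, ?_⟩
    · rw [LinearMap.mem_ker]
      funext z
      simp [Ψ]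
    · intro h
      obtain ⟨z, hz⟩ := hZ
      have h1 := congrArg (fun p => p.1.1 ⟨orb _ z, Finset.mem_image_of_mem _ hz⟩) h
      simp at h1
  have r1 := LinearMap.finrank_range_add_finrank_ker Φ
  have r2 := LinearMap.finrank_range_add_finrank_ker Ψ
  have r3 := Submodule.finrank_mono hker
  have r4 := Submodule.finrank_le (LinearMap.range Φ)
  rw [Module.finrank_prod] at r2
  simp only [Module.finrank_fintype_fun_eq_card, Fintype.card_coe] at r1 r2 r4
  unfold negEuler orbCount
  change 1 + ((Z.card : ℤ) - A.card - B.card) ≤ S.card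
  lia

end LowerBound

section UpperBound

open scoped Classical

variable {F G G' : Type} [Group F] [Group G] [Group G'] (j : G →* F) (j' : G' →* F)
  {X : Type} [MulAction F X]

/-- The elements `p y` carry `x₀` to the points `y` of `Y`, and `S` is a set of elements of the
stabilizer of `x₀` that generates all loops inside `Y`. -/
structure Spans (x₀ : X) (Y : Finset X) (p : X → F) (S : Finset F) : Prop where
  base : x₀ ∈ Y
  p_base : p x₀ = 1
  smul_base : ∀ y ∈ Y, p y • x₀ = y
  left : ∀ y ∈ Y, ∀ g, j g • y ∈ Y →
    (p (j g • y))⁻¹ * j g * p y ∈ Subgroup.closure (S : Set F)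
  right : ∀ y ∈ Y, ∀ g, j' g • y ∈ Y →
    (p (j' g • y))⁻¹ * j' g * p y ∈ Subgroup.closure (S : Set F)
  stab : ∀ s ∈ S, s • x₀ = x₀
  card_le : (S.card : ℤ) ≤ 1 + negEuler j j' Y

variable {j j'}

theorem Spans.symm {x₀ : X} {Y : Finset X} {p : X → F} {S : Finset F} (h : Spans j j' x₀ Y p S) :
    Spans j' j x₀ Y p S :=
  ⟨h.base, h.p_base, h.smul_base, h.right, h.left, h.stab, by
    rw [negEuler_comm]; exact h.card_le⟩

theorem Spans.singleton (hj : ActsFreely j X) (hj' : ActsFreely j' X) (x₀ : X) :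
    Spans j j' x₀ {x₀} (fun _ => 1) ∅ where
  base := by simp
  p_base := rfl
  smul_base := by simp
  left := by
    intro y hy g h
    simp only [Finset.mem_singleton] at hy h
    subst hy
    simp [hj g _ h]
  right := by
    intro y hy g h
    simp only [Finset.mem_singleton] at hy h
    subst hy
    simp [hj' g _ h]
  stab := by simp
  card_le := by simp [negEuler, orbCount]

theorem orbCount_insert_le (w : X) (Y : Finset X) :
    orbCount j (insert w Y) ≤ orbCount j Y + 1 := by
  unfold orbCount
  rw [Finset.image_insert]
  exact Finset.card_insert_le _ _

theorem orbCount_insert_of_mem {w : X} {Y : Finset X} {g : G} (h : j g • w ∈ Y) :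
    orbCount j (insert w Y) = orbCount j Y := by
  unfold orbCount
  rw [Finset.image_insert, Finset.insert_eq_of_mem]
  exact Finset.mem_image.2 ⟨_, h, (orb_eq_iff.2 ⟨g, rfl⟩).symm⟩

theorem transition_insert (hj : ActsFreely j X) {K : Subgroup F} {p p' : X → F} {Y : Finset X}
    (hp : ∀ z ∈ Y, p' z = p z)
    (tr : ∀ y ∈ Y, ∀ g, j g • y ∈ Y → (p (j g • y))⁻¹ * j g * p y ∈ K) {w : X}
    (hw : (∀ k, j k • w ∉ Y) ∨ ∃ k, j k • w ∈ Y ∧ (p (j k • w))⁻¹ * j k * p' w ∈ K) :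
    ∀ y ∈ insert w Y, ∀ g, j g • y ∈ insert w Y → (p' (j g • y))⁻¹ * j g * p' y ∈ K := by
  have out : ∀ k, j k • w ∈ Y → (p (j k • w))⁻¹ * j k * p' w ∈ K := by
    intro k hk
    rcases hw with hw | ⟨l, hl, hl'⟩
    · exact absurd hk (hw k)
    have e : j (k * l⁻¹) • j l • w = j k • w := by simp [mul_smul]
    have := K.mul_mem (tr _ hl (k * l⁻¹) (by rw [e]; exact hk)) hl'
    rw [e] at this
    convert this using 1
    simp [mul_assoc]
  intro y hy g hg
  rcases Finset.mem_insert.1 hy with rfl | hy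
  · rcases Finset.mem_insert.1 hg with h | h
    · rw [hj g _ h]; simp
    · rw [hp _ h]; exact out g h
  · rcases Finset.mem_insert.1 hg with h | h
    · have e : j g⁻¹ • w = y := by rw [← h]; simp
      have := K.inv_mem (out g⁻¹ (by rw [e]; exact hy))
      rw [e] at this
      rw [h, hp _ hy]
      convert this using 1
      simp [mul_assoc]
    · rw [hp _ hy, hp _ h]; exact tr y hy g h

theorem Spans.extend (hj : ActsFreely j X) (hj' : ActsFreely j' X) {x₀ : X} {Y : Finset X}
    {p : X → F} {S : Finset F} (h : Spans j j' x₀ Y p S) {y : X} (hy : y ∈ Y) {g : G}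
    (hg : j g • y ∉ Y) :
    ∃ p' S', Spans j j' x₀ (insert (j g • y) Y) p' S' ∧ (∀ z ∈ Y, p' z = p z) ∧
      p' (j g • y) = j g * p y ∧
      ((S' = S ∧ (∀ k, j' k • j g • y ∉ Y) ∧ negEuler j j' Y ≤ negEuler j j' (insert (j g • y) Y)) ∨
        negEuler j j' Y < negEuler j j' (insert (j g • y) Y)) := by
  set w := j g • y with hw
  let p' := Function.update p w (j g * p y)
  have hp : ∀ z ∈ Y, p' z = p z := fun z hz =>
    Function.update_of_ne (fun e => hg (by rw [← e]; exact hz)) _ _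
  have hpw : p' w = j g * p y := Function.update_self _ _ _
  have hback : j g⁻¹ • w = y := by rw [hw]; simp
  have hA : orbCount j (insert w Y) = orbCount j Y :=
    orbCount_insert_of_mem (g := g⁻¹) (by rw [hback]; exact hy)
  have hcard : (insert w Y).card = Y.card + 1 := Finset.card_insert_of_notMem hg
  have hsm : ∀ z ∈ insert w Y, p' z • x₀ = z := by
    intro z hz
    rcases Finset.mem_insert.1 hz with rfl | hz
    · rw [hpw, mul_smul, h.smul_base y hy]
    · rw [hp z hz, h.smul_base z hz]
  have hpb : p' x₀ = 1 := by rw [hp _ h.base, h.p_base]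
  have hleft : ∀ K : Subgroup F, Subgroup.closure (S : Set F) ≤ K →
      ∀ z ∈ insert w Y, ∀ k, j k • z ∈ insert w Y → (p' (j k • z))⁻¹ * j k * p' z ∈ K := by
    intro K hK
    refine transition_insert hj hp (fun z hz k hk => hK (h.left z hz k hk)) (Or.inr ⟨g⁻¹, ?_⟩)
    rw [hback, hpw]
    exact ⟨hy, by simp⟩
  have hc := h.card_le
  by_cases hB : ∃ k, j' k • w ∈ Y
  · obtain ⟨k, hk⟩ := hB
    have hBc := orbCount_insert_of_mem hk
    let s := (p (j' k • w))⁻¹ * j' k * p' w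
    have hle : Subgroup.closure (S : Set F) ≤ Subgroup.closure (insert s S : Finset F) :=
      Subgroup.closure_mono (by simp)
    refine ⟨p', insert s S, ⟨Finset.mem_insert_of_mem h.base, hpb, hsm, hleft _ hle, ?_, ?_, ?_⟩,
      hp, hpw, Or.inr ?_⟩
    · refine transition_insert hj' hp (fun z hz l hl => hle (h.right z hz l hl))
        (Or.inr ⟨k, hk, Subgroup.subset_closure ?_⟩)
      simp [s]
    · intro t ht
      rcases Finset.mem_insert.1 ht with rfl | ht
      · rw [mul_smul, mul_smul, hsm w (Finset.mem_insert_self _ _), inv_smul_eq_iff,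
          h.smul_base _ hk]
      · exact h.stab t ht
    · have := Finset.card_insert_le s S
      unfold negEuler at hc ⊢
      lia
    · unfold negEuler
      lia
  · push Not at hB
    have hBc := orbCount_insert_le (j := j') w Y
    have hle : negEuler j j' Y ≤ negEuler j j' (insert w Y) := by
      unfold negEuler
      lia
    exact ⟨p', S, ⟨Finset.mem_insert_of_mem h.base, hpb, hsm, hleft _ le_rfl,
      transition_insert hj' hp h.right (Or.inl hB), h.stab, by lia⟩, hp, hpw,
      Or.inl ⟨rfl, hB, hle⟩⟩

variable (j j') in
/-- Restricting finite graphs over `Y'` to their part over `Y` does not decrease the negated Euler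
characteristic. -/
def Retracts (Y Y' : Finset X) : Prop :=
  ∀ (W : Type) [MulAction F W] (φ : W → X), (∀ (f : F) w, φ (f • w) = f • φ w) →
    ∀ Z : Finset W, negEuler j j' (Z.filter (φ · ∈ Y')) ≤ negEuler j j' (Z.filter (φ · ∈ Y))

variable (j j') in
/-- Restricting finite graphs over `X` to their part over `Y` does not decrease the negated Euler
characteristic. -/
def IsCore (Y : Finset X) : Prop :=
  ∀ (W : Type) [MulAction F W] (φ : W → X), (∀ (f : F) w, φ (f • w) = f • φ w) →
    ∀ Z : Finset W, negEuler j j' Z ≤ negEuler j j' (Z.filter (φ · ∈ Y))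

theorem Retracts.symm {Y Y' : Finset X} (h : Retracts j j' Y Y') : Retracts j' j Y Y' := by
  intro W _ φ hφ Z
  rw [negEuler_comm j' j, negEuler_comm j' j]
  exact h W φ hφ Z

theorem Retracts.trans {Y Y' Y'' : Finset X} (h : Retracts j j' Y Y') (h' : Retracts j j' Y' Y'') :
    Retracts j j' Y Y'' :=
  fun W _ φ hφ Z => (h' W φ hφ Z).trans (h W φ hφ Z)

theorem retracts_insert (hj' : ActsFreely j' X) {Y : Finset X} {w : X} (hw : ∀ k, j' k • w ∉ Y) :
    Retracts j j' Y (insert w Y) := by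
  intro W _ φ hφ Z
  have hwY : w ∉ Y := by simpa using hw 1
  have e : Z.filter (φ · ∈ Y) = Z.filter (φ · ∈ insert w Y) \ Z.filter (φ · = w) := by
    ext z
    simp only [Finset.mem_filter, Finset.mem_sdiff, Finset.mem_insert]
    constructor
    · rintro ⟨h1, h2⟩
      refine ⟨⟨h1, Or.inr h2⟩, ?_⟩
      rintro ⟨-, h3⟩
      exact hwY (h3 ▸ h2)
    · rintro ⟨⟨h1, h2⟩, h3⟩
      exact ⟨h1, h2.resolve_left fun h => h3 ⟨h1, h⟩⟩
  rw [e]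
  refine negEuler_le_sdiff ?_ ?_
  · intro z hz
    have := Finset.mem_filter.1 hz
    exact Finset.mem_filter.2 ⟨this.1, by simp [this.2]⟩
  · intro z hz g hg
    have h1 := (Finset.mem_filter.1 hz).2
    have h2 := (Finset.mem_filter.1 hg).2
    rw [hφ, h1] at h2
    rcases Finset.mem_insert.1 h2 with h | h
    · rw [hj' g _ h]; simp
    · exact absurd h (hw g)

theorem Spans.extend_of_max (hj : ActsFreely j X) (hj' : ActsFreely j' X) {x₀ : X}
    {Y : Finset X} {p : X → F} {S : Finset F} (h : Spans j j' x₀ Y p S)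
    (hmax : ∀ Y' p' S', Spans j j' x₀ Y' p' S' → negEuler j j' Y' ≤ negEuler j j' Y)
    {y : X} (hy : y ∈ Y) (g : G) :
    ∃ Y' p', Spans j j' x₀ Y' p' S ∧ negEuler j j' Y' = negEuler j j' Y ∧
      Retracts j j' Y Y' ∧ Y ⊆ Y' ∧ j g • y ∈ Y' ∧ (p' (j g • y))⁻¹ * j g * p' y
        ∈ Subgroup.closure (S : Set F) ∧ ∀ z ∈ Y, p' z = p z := by
  by_cases hg : j g • y ∈ Y
  · exact ⟨Y, p, h, rfl, fun W _ φ hφ Z => le_rfl, subset_rfl, hg, h.left y hy g hg,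
      fun z _ => rfl⟩
  · obtain ⟨p', S', h', hp, hpw, ⟨rfl, hleaf, hle⟩ | hlt⟩ := h.extend hj hj' hy hg
    · exact ⟨_, p', h', le_antisymm (hmax _ _ _ h') hle, retracts_insert hj' hleaf,
        Finset.subset_insert _ _, Finset.mem_insert_self _ _,
        h'.left y (Finset.mem_insert_of_mem hy) g (Finset.mem_insert_self _ _), hp⟩
    · exact absurd (hmax _ _ _ h') (not_le.2 hlt)

/-- If the negated Euler characteristic of finite subgraphs of a transitive `F`-set is bounded,
then there is a finite core whose Euler characteristic bounds the number of generators of a point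
stabilizer. -/
theorem exists_core [MulAction.IsPretransitive F X] (hj : ActsFreely j X)
    (hj' : ActsFreely j' X) (hgen : Subgroup.closure (Set.range j ∪ Set.range j') = ⊤) (x₀ : X)
    (B : ℤ) (hB : ∀ Z : Finset X, negEuler j j' Z ≤ B) :
    ∃ (Y : Finset X) (S : Finset F), x₀ ∈ Y ∧
      Subgroup.closure (S : Set F) = MulAction.stabilizer F x₀ ∧
      (S.card : ℤ) ≤ 1 + negEuler j j' Y ∧ IsCore j j' Y := by
  obtain ⟨m, ⟨Y, p, S, hY, hm⟩, hmax⟩ := Int.exists_greatest_of_bdd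
    (P := fun m => ∃ (Y : Finset X) (p : X → F) (S : Finset F),
      Spans j j' x₀ Y p S ∧ negEuler j j' Y = m)
    ⟨B, by rintro m ⟨Y, p, S, -, rfl⟩; exact hB Y⟩ ⟨_, _, _, _, Spans.singleton hj hj' x₀, rfl⟩
  have hmax' : ∀ Y' p' S', Spans j j' x₀ Y' p' S' → negEuler j j' Y' ≤ m :=
    fun Y' p' S' h => hmax _ ⟨Y', p', S', h, rfl⟩
  have step : ∀ (f : F) (Y' : Finset X) (p' : X → F), Spans j j' x₀ Y' p' S →
      negEuler j j' Y' = m →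
      ∃ Y'' p'', Spans j j' x₀ Y'' p'' S ∧ negEuler j j' Y'' = m ∧ Retracts j j' Y' Y'' ∧
        Y' ⊆ Y'' ∧ f • x₀ ∈ Y'' ∧ (p'' (f • x₀))⁻¹ * f ∈ Subgroup.closure (S : Set F) := by
    intro f Y' p' h' hm'
    have hf : f ∈ Subgroup.closure (Set.range j ∪ Set.range j') := by rw [hgen]; trivial
    have one_step : ∀ t ∈ Set.range j ∪ Set.range j', ∀ (Z : Finset X) (q : X → F),
        Spans j j' x₀ Z q S → negEuler j j' Z = m → ∀ z ∈ Z,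
        ∃ Z' q', Spans j j' x₀ Z' q' S ∧ negEuler j j' Z' = negEuler j j' Z ∧
          Retracts j j' Z Z' ∧ Z ⊆ Z' ∧ t • z ∈ Z' ∧ (q' (t • z))⁻¹ * t * q' z
            ∈ Subgroup.closure (S : Set F) ∧ ∀ y ∈ Z, q' y = q y := by
      rintro t (⟨g, rfl⟩ | ⟨g, rfl⟩) Z q hZ hZm z hz
      · exact hZ.extend_of_max hj hj' (by rw [hZm]; exact hmax') hz g
      · obtain ⟨Z', q', h1, h2, h3, h4⟩ := hZ.symm.extend_of_max hj' hj (by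
          rw [negEuler_comm, hZm]
          intro Y' p' S' h
          rw [negEuler_comm]
          exact hmax' _ _ _ h.symm) hz g
        exact ⟨Z', q', h1.symm, by rwa [negEuler_comm j' j, negEuler_comm j' j] at h2, h3.symm, h4⟩
    have mul_step : ∀ t ∈ Set.range j ∪ Set.range j', ∀ f : F,
        (∃ Y'' p'', Spans j j' x₀ Y'' p'' S ∧ negEuler j j' Y'' = m ∧ Retracts j j' Y' Y'' ∧
          Y' ⊆ Y'' ∧ f • x₀ ∈ Y'' ∧ (p'' (f • x₀))⁻¹ * f ∈ Subgroup.closure (S : Set F)) →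
        ∃ Y'' p'', Spans j j' x₀ Y'' p'' S ∧ negEuler j j' Y'' = m ∧ Retracts j j' Y' Y'' ∧
          Y' ⊆ Y'' ∧ (t * f) • x₀ ∈ Y'' ∧
          (p'' ((t * f) • x₀))⁻¹ * (t * f) ∈ Subgroup.closure (S : Set F) := by
      rintro t ht f ⟨Z, q, h1, h2, h3, h4, h5, h6⟩
      obtain ⟨Z', q', k1, k2, k3, k4, k5, k6, k7⟩ := one_step t ht Z q h1 h2 _ h5
      refine ⟨Z', q', k1, k2.trans h2, h3.trans k3, h4.trans k4, by rw [mul_smul]; exact k5, ?_⟩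
      rw [k7 _ h5] at k6
      have := Subgroup.mul_mem _ k6 h6
      rw [mul_smul]
      convert this using 1
      group
    induction hf using Subgroup.closure_induction_left with
    | one =>
      exact ⟨Y', p', h', hm', fun W _ φ hφ Z => le_rfl, subset_rfl, by simpa using h'.base,
        by simp [h'.p_base]⟩
    | mul_left t ht f _ ih => exact mul_step t ht f ih
    | inv_mul_cancel t ht f _ ih =>
      refine mul_step t⁻¹ ?_ f ih
      rcases ht with ⟨g, rfl⟩ | ⟨g, rfl⟩
      · exact Or.inl ⟨g⁻¹, by simp⟩
      · exact Or.inr ⟨g⁻¹, by simp⟩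
  refine ⟨Y, S, hY.base, ?_, hY.card_le, ?_⟩
  · apply le_antisymm
    · rw [Subgroup.closure_le]
      exact fun s hs => hY.stab s hs
    · intro f hf
      obtain ⟨Y', p', h1, -, -, -, -, h2⟩ := step f Y p hY hm
      rw [MulAction.mem_stabilizer_iff.1 hf, h1.p_base] at h2
      simpa using h2
  · have cover : ∀ Q : Finset X, ∃ Y' p', Spans j j' x₀ Y' p' S ∧ negEuler j j' Y' = m ∧
        Retracts j j' Y Y' ∧ Q ⊆ Y' := by
      intro Q
      induction Q using Finset.induction_on with
      | empty => exact ⟨Y, p, hY, hm, fun W _ φ hφ Z => le_rfl, by simp⟩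
      | insert q Q _ ih =>
        obtain ⟨Z, r, h1, h2, h3, h4⟩ := ih
        obtain ⟨f, rfl⟩ := MulAction.exists_smul_eq F x₀ q
        obtain ⟨Z', r', k1, k2, k3, k4, k5, -⟩ := step f Z r h1 h2
        exact ⟨Z', r', k1, k2, h3.trans k3, Finset.insert_subset k5 (h4.trans k4)⟩
    intro W _ φ hφ Z
    obtain ⟨Y', -, -, -, h, hQ⟩ := cover (Z.image φ)
    have := h W φ hφ Z
    rwa [Finset.filter_true_of_mem fun z hz => hQ (Finset.mem_image_of_mem _ hz)] at this

end UpperBound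

section Ranks

open scoped Classical

theorem rk_le_card {F : Type} [Group F] {H : Subgroup F} {S : Finset F}
    (hS : Subgroup.closure (S : Set F) = H) : rk H ≤ S.card :=
  Nat.sInf_le ⟨S, rfl, hS⟩

theorem exists_card_eq_rk {F : Type} [Group F] {H : Subgroup F} (hH : H.FG) :
    ∃ S : Finset F, S.card = rk H ∧ Subgroup.closure (S : Set F) = H :=
  Nat.sInf_mem (s := {n | ∃ S : Finset F, S.card = n ∧ Subgroup.closure (S : Set F) = H})
    (let ⟨S, hS⟩ := hH; ⟨_, S, rfl, hS⟩)

theorem two_le_rk {F : Type} [Group F] {H : Subgroup F} (hH : H.FG) (hc : Noncyclic H) :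
    2 ≤ rk H := by
  obtain ⟨S, hS, hSH⟩ := exists_card_eq_rk hH
  by_contra hlt
  have h1 : S.card ≤ 1 := by lia
  obtain ⟨g, hg⟩ := Finset.card_le_one_iff_subset_singleton.1 h1
  rcases Finset.subset_singleton_iff.1 hg with rfl | rfl
  · exact hc 1 (by rw [← hSH]; simp [Subgroup.closure_singleton_one])
  · exact hc g (by rw [← hSH]; simp)

theorem noncyclic_of_two_le_rk {F : Type} [Group F] {H : Subgroup F} (h : 2 ≤ rk H) :
    Noncyclic H := by
  intro g hg
  have := rk_le_card (H := H) (S := {g}) (by simp [hg])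
  simp at this
  lia

theorem mem_conjS {F : Type} [Group F] {K : Subgroup F} {s f : F} :
    f ∈ conjS s K ↔ s⁻¹ * f * s ∈ K := by
  unfold conjS
  rw [Subgroup.mem_map]
  constructor
  · rintro ⟨k, hk, rfl⟩
    simpa [mul_assoc] using hk
  · intro h
    exact ⟨_, h, by simp [mul_assoc]⟩

variable (G1 G2 : Type) [Group G1] [Group G2]

/-- The negated Euler characteristic of a finite subset of a `G1 ∗ G2`-set. -/
noncomputable abbrev nEuler {X : Type} [MulAction (Coprod G1 G2) X] (Z : Finset X) : ℤ :=
  negEuler (Coprod.inl : G1 →* Coprod G1 G2) (Coprod.inr : G2 →* Coprod G1 G2) Z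

/-- Both factors of `G1 ∗ G2` act freely on `X`. -/
def FactorsFree (X : Type) [MulAction (Coprod G1 G2) X] : Prop :=
  ActsFreely (Coprod.inl : G1 →* Coprod G1 G2) X ∧ ActsFreely (Coprod.inr : G2 →* Coprod G1 G2) X

variable {G1 G2}

theorem FactorsFree.of_map {X W : Type} [MulAction (Coprod G1 G2) X] [MulAction (Coprod G1 G2) W]
    (hX : FactorsFree G1 G2 X) (φ : W → X) (hφ : ∀ (f : Coprod G1 G2) w, φ (f • w) = f • φ w) :
    FactorsFree G1 G2 W :=
  ⟨fun g w h => hX.1 g (φ w) (by rw [← hφ, h]), fun g w h => hX.2 g (φ w) (by rw [← hφ, h])⟩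

theorem FactorFree2.factorsFree {H : Subgroup (Coprod G1 G2)} (hH : FactorFree2 H) :
    FactorsFree G1 G2 (Coprod G1 G2 ⧸ H) := by
  constructor
  · intro g x hx
    induction x using QuotientGroup.induction_on with
    | H f =>
    have h1 : f⁻¹ * Coprod.inl g * f ∈ H := by
      have := QuotientGroup.eq.1 (show ((f : Coprod G1 G2) : Coprod G1 G2 ⧸ H) =
        ((Coprod.inl g * f : Coprod G1 G2) : Coprod G1 G2 ⧸ H) from hx.symm)
      rwa [← mul_assoc] at this
    have h2 : f⁻¹ * Coprod.inl g * f ∈ H ⊓ conjS f⁻¹ (Coprod.inl : G1 →* Coprod G1 G2).range :=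
      ⟨h1, mem_conjS.2 ⟨g, by group⟩⟩
    rw [(hH f⁻¹).1, Subgroup.mem_bot] at h2
    have h3 : (Coprod.inl g : Coprod G1 G2) = 1 := by
      have := congrArg (fun t => f * t * f⁻¹) h2
      simpa [mul_assoc] using this
    exact Coprod.inl_injective (by rw [h3, map_one])
  · intro g x hx
    induction x using QuotientGroup.induction_on with
    | H f =>
    have h1 : f⁻¹ * Coprod.inr g * f ∈ H := by
      have := QuotientGroup.eq.1 (show ((f : Coprod G1 G2) : Coprod G1 G2 ⧸ H) =
        ((Coprod.inr g * f : Coprod G1 G2) : Coprod G1 G2 ⧸ H) from hx.symm)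
      rwa [← mul_assoc] at this
    have h2 : f⁻¹ * Coprod.inr g * f ∈ H ⊓ conjS f⁻¹ (Coprod.inr : G2 →* Coprod G1 G2).range :=
      ⟨h1, mem_conjS.2 ⟨g, by group⟩⟩
    rw [(hH f⁻¹).2, Subgroup.mem_bot] at h2
    have h3 : (Coprod.inr g : Coprod G1 G2) = 1 := by
      have := congrArg (fun t => f * t * f⁻¹) h2
      simpa [mul_assoc] using this
    exact Coprod.inr_injective (by rw [h3, map_one])

theorem factorFree2_of_le_stabilizer {X : Type} [MulAction (Coprod G1 G2) X]
    (hX : FactorsFree G1 G2 X) {x : X} {H : Subgroup (Coprod G1 G2)}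
    (hH : H ≤ MulAction.stabilizer (Coprod G1 G2) x) : FactorFree2 H := by
  intro s
  constructor
  · rw [eq_bot_iff]
    rintro f ⟨hf, hf'⟩
    obtain ⟨g, hg⟩ := mem_conjS.1 hf'
    have h1 : f • x = x := hH hf
    have : g = 1 := hX.1 g (s⁻¹ • x) (by rw [hg, ← mul_smul, mul_inv_cancel_right, mul_smul, h1])
    rw [this, map_one] at hg
    rw [Subgroup.mem_bot]
    have h2 := congrArg (fun t => s * t * s⁻¹) hg
    simpa [mul_assoc] using h2.symm
  · rw [eq_bot_iff]
    rintro f ⟨hf, hf'⟩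
    obtain ⟨g, hg⟩ := mem_conjS.1 hf'
    have h1 : f • x = x := hH hf
    have : g = 1 := hX.2 g (s⁻¹ • x) (by rw [hg, ← mul_smul, mul_inv_cancel_right, mul_smul, h1])
    rw [this, map_one] at hg
    rw [Subgroup.mem_bot]
    have h2 := congrArg (fun t => s * t * s⁻¹) hg
    simpa [mul_assoc] using h2.symm

section Transitive

variable {X : Type} [MulAction (Coprod G1 G2) X] [MulAction.IsPretransitive (Coprod G1 G2) X]

theorem one_add_nEuler_le_rk (x₀ : X) (hfg : (MulAction.stabilizer (Coprod G1 G2) x₀).FG)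
    (Z : Finset X) (hZ : Z.Nonempty) :
    1 + nEuler G1 G2 Z ≤ rk (MulAction.stabilizer (Coprod G1 G2) x₀) := by
  obtain ⟨S, hS, hSH⟩ := exists_card_eq_rk hfg
  rw [← hS]
  exact one_add_negEuler_le x₀ S hSH Z hZ

theorem nEuler_le_rrk (x₀ : X) (hfg : (MulAction.stabilizer (Coprod G1 G2) x₀).FG)
    (Z : Finset X) : nEuler G1 G2 Z ≤ rrk (MulAction.stabilizer (Coprod G1 G2) x₀) := by
  rcases Z.eq_empty_or_nonempty with rfl | hZ
  · simp
  · have := one_add_nEuler_le_rk x₀ hfg Z hZ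
    unfold rrk
    lia

theorem exists_core_rk (hX : FactorsFree G1 G2 X) (x₀ : X)
    (B : ℤ) (hB : ∀ Z : Finset X, nEuler G1 G2 Z ≤ B) :
    (MulAction.stabilizer (Coprod G1 G2) x₀).FG ∧ ∃ Y : Finset X, x₀ ∈ Y ∧
      (rk (MulAction.stabilizer (Coprod G1 G2) x₀) : ℤ) = 1 + nEuler G1 G2 Y ∧
      IsCore (Coprod.inl : G1 →* Coprod G1 G2) Coprod.inr Y := by
  obtain ⟨Y, S, hY, hS, hc, hcore⟩ := exists_core hX.1 hX.2
    (Coprod.closure_range_inl_union_inr) x₀ B hB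
  have hfg : (MulAction.stabilizer (Coprod G1 G2) x₀).FG := ⟨S, hS⟩
  refine ⟨hfg, Y, hY, le_antisymm ?_ (one_add_nEuler_le_rk x₀ hfg Y ⟨_, hY⟩), hcore⟩
  exact le_trans (by exact_mod_cast rk_le_card hS) hc

theorem exists_nEuler_eq_rrk (hX : FactorsFree G1 G2 X) (x₀ : X)
    (B : ℤ) (hB : ∀ Z : Finset X, nEuler G1 G2 Z ≤ B) :
    (∃ Z : Finset X, nEuler G1 G2 Z = rrk (MulAction.stabilizer (Coprod G1 G2) x₀)) ∧
      ∀ Z : Finset X, nEuler G1 G2 Z ≤ rrk (MulAction.stabilizer (Coprod G1 G2) x₀) := by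
  obtain ⟨hfg, Y, -, hY, -⟩ := exists_core_rk hX x₀ B hB
  refine ⟨?_, nEuler_le_rrk x₀ hfg⟩
  by_cases h : rk (MulAction.stabilizer (Coprod G1 G2) x₀) = 0
  · exact ⟨∅, by simp [rrk, h]⟩
  · refine ⟨Y, ?_⟩
    unfold rrk
    lia

end Transitive

theorem FactorsFree.exists_nEuler_eq_rrk_stabilizer {X : Type} [MulAction (Coprod G1 G2) X]
    (hX : FactorsFree G1 G2 X) (x₀ : X) (B : ℤ) (hB : ∀ Z : Finset X, nEuler G1 G2 Z ≤ B) :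
    (∃ Z : Finset X, (∀ z ∈ Z, z ∈ MulAction.orbit (Coprod G1 G2) x₀) ∧
      nEuler G1 G2 Z = rrk (MulAction.stabilizer (Coprod G1 G2) x₀)) ∧
    ∀ Z : Finset X, (∀ z ∈ Z, z ∈ MulAction.orbit (Coprod G1 G2) x₀) →
      nEuler G1 G2 Z ≤ rrk (MulAction.stabilizer (Coprod G1 G2) x₀) := by
  have hst : MulAction.stabilizer (Coprod G1 G2)
      (⟨x₀, MulAction.mem_orbit_self _⟩ : MulAction.orbit (Coprod G1 G2) x₀) =
      MulAction.stabilizer (Coprod G1 G2) x₀ := by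
    ext f
    rw [MulAction.mem_stabilizer_iff, MulAction.mem_stabilizer_iff, Subtype.ext_iff]
    rfl
  have himg : ∀ Z : Finset (MulAction.orbit (Coprod G1 G2) x₀),
      nEuler G1 G2 (Z.image Subtype.val) = nEuler G1 G2 Z := fun Z =>
    negEuler_image (fun z _ z' _ g => Subtype.ext_iff) (fun z _ z' _ g => Subtype.ext_iff)
  obtain ⟨⟨Z, hZ⟩, hle⟩ := exists_nEuler_eq_rrk (X := MulAction.orbit (Coprod G1 G2) x₀)
    (hX.of_map Subtype.val (fun f w => rfl))
    ⟨x₀, MulAction.mem_orbit_self _⟩ B (fun Z => himg Z ▸ hB _)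
  rw [hst] at hZ hle
  refine ⟨⟨Z.image Subtype.val, ?_, (himg Z).trans hZ⟩, fun Z' hZ' => ?_⟩
  · intro z hz
    obtain ⟨w, -, rfl⟩ := Finset.mem_image.1 hz
    exact w.2
  · have e : (Z'.subtype (· ∈ MulAction.orbit (Coprod G1 G2) x₀)).image Subtype.val = Z' := by
      ext z
      simp only [Finset.mem_image, Finset.mem_subtype, Subtype.exists, exists_and_right,
        exists_eq_right]
      exact ⟨fun h => h.2, fun h => ⟨hZ' z h, h⟩⟩
    rw [← e, himg]
    exact hle _

theorem exists_core_quotient {H : Subgroup (Coprod G1 G2)} (hH : FactorFree2 H) (hfg : H.FG) :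
    ∃ Y : Finset (Coprod G1 G2 ⧸ H), Y.Nonempty ∧ (rk H : ℤ) = 1 + nEuler G1 G2 Y ∧
      IsCore (Coprod.inl : G1 →* Coprod G1 G2) Coprod.inr Y := by
  have hst := MulAction.stabilizer_quotient H
  obtain ⟨-, Y, h1, h2, h3⟩ := exists_core_rk hH.factorsFree ((1 : Coprod G1 G2) : Coprod G1 G2 ⧸ H)
    (rrk H) (fun Z => by
      have := nEuler_le_rrk ((1 : Coprod G1 G2) : Coprod G1 G2 ⧸ H) (hst.symm ▸ hfg) Z
      rwa [hst] at this)
  rw [hst] at h2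
  exact ⟨Y, ⟨_, h1⟩, h2, h3⟩

end Ranks

section DoubleCosets

open scoped Classical

variable {F : Type} [Group F] (H K : Subgroup F)

/-- The double coset attached to a pair of left cosets. -/
noncomputable def pairCoset (w : (F ⧸ H) × (F ⧸ K)) : Quotient (dcSetoid H K) :=
  Quotient.mk (dcSetoid H K) (w.1.out⁻¹ * w.2.out)

variable {H K}

theorem exists_smul_out (f : F) (x : F ⧸ H) : ∃ h ∈ H, (f • x).out = f * x.out * h := by
  refine ⟨(f * x.out)⁻¹ * (f • x).out, ?_, by group⟩
  rw [← QuotientGroup.eq, QuotientGroup.out_eq']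
  conv_rhs => rw [← QuotientGroup.out_eq' x]
  rfl

theorem pairCoset_smul (f : F) (w : (F ⧸ H) × (F ⧸ K)) :
    pairCoset H K (f • w) = pairCoset H K w := by
  obtain ⟨h, hh, e⟩ := exists_smul_out f w.1
  obtain ⟨k, hk, e'⟩ := exists_smul_out f w.2
  refine (Quotient.sound (s := dcSetoid H K) ⟨h⁻¹, H.inv_mem hh, k, hk, ?_⟩).symm
  rw [Prod.smul_fst, Prod.smul_snd, e, e']
  group

variable (H K) in
/-- A pair of left cosets representing a double coset. -/
noncomputable def basePair (q : Quotient (dcSetoid H K)) : (F ⧸ H) × (F ⧸ K) :=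
  (((1 : F) : F ⧸ H), (q.out : F ⧸ K))

theorem pairCoset_basePair (q : Quotient (dcSetoid H K)) : pairCoset H K (basePair H K q) = q := by
  have h1 : (((1 : F) : F ⧸ H).out)⁻¹ ∈ H := by
    have := QuotientGroup.eq.1 (QuotientGroup.out_eq' ((1 : F) : F ⧸ H))
    simpa using this
  have h2 : q.out⁻¹ * ((q.out : F ⧸ K)).out ∈ K := by
    rw [← QuotientGroup.eq, QuotientGroup.out_eq']
  conv_rhs => rw [← Quotient.out_eq q]
  exact (Quotient.sound (s := dcSetoid H K) ⟨_, h1, _, h2, by simp [basePair]⟩).symm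

theorem mem_orbit_basePair (w : (F ⧸ H) × (F ⧸ K)) :
    w ∈ MulAction.orbit F (basePair H K (pairCoset H K w)) := by
  obtain ⟨h, hh, k, hk, e⟩ := Quotient.mk_out (s := dcSetoid H K) (w.1.out⁻¹ * w.2.out)
  have e' : (pairCoset H K w).out = h⁻¹ * (w.1.out⁻¹ * w.2.out) * k⁻¹ := by
    rw [← e, pairCoset]; group
  refine ⟨w.1.out * h, Prod.ext ?_ ?_⟩
  · change (((w.1.out * h) * 1 : F) : F ⧸ H) = w.1
    rw [mul_one, QuotientGroup.mk_mul_of_mem _ hh, QuotientGroup.out_eq']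
  · change (((w.1.out * h) * (pairCoset H K w).out : F) : F ⧸ K) = w.2
    rw [e']
    have : w.1.out * h * (h⁻¹ * (w.1.out⁻¹ * w.2.out) * k⁻¹) = w.2.out * k⁻¹ := by group
    rw [this, QuotientGroup.mk_mul_of_mem _ (K.inv_mem hk), QuotientGroup.out_eq']

theorem stabilizer_basePair (q : Quotient (dcSetoid H K)) :
    MulAction.stabilizer F (basePair H K q) = H ⊓ conjS q.out K := by
  ext f
  rw [MulAction.mem_stabilizer_iff, Subgroup.mem_inf, mem_conjS, Prod.ext_iff]
  refine and_congr ?_ ?_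
  · change ((f * 1 : F) : F ⧸ H) = ((1 : F) : F ⧸ H) ↔ _
    rw [QuotientGroup.eq]
    simp
  · change ((f * q.out : F) : F ⧸ K) = ((q.out : F) : F ⧸ K) ↔ _
    rw [eq_comm, QuotientGroup.eq, mul_assoc]

end DoubleCosets

section GeneralizedIntersection

open scoped Classical

variable {G1 G2 : Type} [Group G1] [Group G2] {H1 H2 : Subgroup (Coprod G1 G2)}

theorem rrk_inf_conjS_spec (h1 : FactorFree2 H1) {Y1 : Finset (Coprod G1 G2 ⧸ H1)}
    {Y2 : Finset (Coprod G1 G2 ⧸ H2)}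
    (hY1 : IsCore (Coprod.inl : G1 →* Coprod G1 G2) Coprod.inr Y1)
    (hY2 : IsCore (Coprod.inl : G1 →* Coprod G1 G2) Coprod.inr Y2)
    (q : Quotient (dcSetoid H1 H2)) :
    (∃ Z ⊆ Y1 ×ˢ Y2, (∀ z ∈ Z, pairCoset H1 H2 z = q) ∧
      nEuler G1 G2 Z = rrk (H1 ⊓ conjS q.out H2)) ∧
    ∀ Z, (∀ z ∈ Z, pairCoset H1 H2 z = q) → nEuler G1 G2 Z ≤ rrk (H1 ⊓ conjS q.out H2) := by
  have hfilter : ∀ Z : Finset ((Coprod G1 G2 ⧸ H1) × (Coprod G1 G2 ⧸ H2)),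
      nEuler G1 G2 Z ≤ nEuler G1 G2 ((Z.filter (·.1 ∈ Y1)).filter (·.2 ∈ Y2)) := fun Z => by
    refine ((hY1 _ Prod.fst (fun f w => rfl) Z).trans
      (hY2 _ Prod.snd (fun f w => rfl) _)).trans_eq (congrArg _ ?_)
    ext z
    simp only [Finset.mem_filter]
  have hsub : ∀ Z : Finset ((Coprod G1 G2 ⧸ H1) × (Coprod G1 G2 ⧸ H2)),
      (Z.filter (·.1 ∈ Y1)).filter (·.2 ∈ Y2) ⊆ Y1 ×ˢ Y2 := by
    intro Z z hz
    simp only [Finset.mem_filter] at hz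
    exact Finset.mem_product.2 ⟨hz.1.2, hz.2⟩
  have hπ : ∀ z ∈ MulAction.orbit (Coprod G1 G2) (basePair H1 H2 q), pairCoset H1 H2 z = q := by
    rintro z ⟨f, rfl⟩
    exact (pairCoset_smul f _).trans (pairCoset_basePair q)
  have hfree : FactorsFree G1 G2 ((Coprod G1 G2 ⧸ H1) × (Coprod G1 G2 ⧸ H2)) :=
    h1.factorsFree.of_map Prod.fst (fun f w => rfl)
  obtain ⟨⟨Z, hZo, hZ⟩, hle⟩ := hfree.exists_nEuler_eq_rrk_stabilizer (basePair H1 H2 q)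
    (Y1 ×ˢ Y2).card (fun Z => by
      refine (hfilter _).trans ((negEuler_le_card _ _ _).trans ?_)
      exact_mod_cast Finset.card_le_card (hsub _))
  rw [stabilizer_basePair] at hZ hle
  have hle' : ∀ Z, (∀ z ∈ Z, pairCoset H1 H2 z = q) →
      nEuler G1 G2 Z ≤ rrk (H1 ⊓ conjS q.out H2) := by
    refine fun Z hZq => hle Z fun z hz => ?_
    have := mem_orbit_basePair z
    rwa [hZq z hz] at this
  have hZq : ∀ z ∈ (Z.filter (·.1 ∈ Y1)).filter (·.2 ∈ Y2), pairCoset H1 H2 z = q :=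
    fun z hz => hπ z (hZo z (Finset.filter_subset _ _ (Finset.filter_subset _ _ hz)))
  exact ⟨⟨_, hsub Z, hZq, le_antisymm (hle' _ hZq) (hZ ▸ hfilter Z)⟩, hle'⟩

/-- The reduced rank of the generalized intersection is the maximal negated Euler characteristic
of a finite subset of the product of the coset spaces, and it is attained over the cores. -/
theorem rrkInter_spec (h1 : FactorFree2 H1) {Y1 : Finset (Coprod G1 G2 ⧸ H1)}
    {Y2 : Finset (Coprod G1 G2 ⧸ H2)}
    (hY1 : IsCore (Coprod.inl : G1 →* Coprod G1 G2) Coprod.inr Y1)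
    (hY2 : IsCore (Coprod.inl : G1 →* Coprod G1 G2) Coprod.inr Y2) :
    (∃ Z ⊆ Y1 ×ˢ Y2, nEuler G1 G2 Z = rrkInter H1 H2) ∧
      ∀ Z : Finset ((Coprod G1 G2 ⧸ H1) × (Coprod G1 G2 ⧸ H2)),
        nEuler G1 G2 Z ≤ rrkInter H1 H2 := by
  choose Zq hsub hπ hZq using fun q => (rrk_inf_conjS_spec h1 hY1 hY2 q).1
  have hle := fun q => (rrk_inf_conjS_spec h1 hY1 hY2 q).2
  let Q := (Y1 ×ˢ Y2).image (pairCoset H1 H2)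
  have hsupp : ∀ q, rrk (H1 ⊓ conjS q.out H2) ≠ 0 → q ∈ Q := by
    intro q hq
    rcases (Zq q).eq_empty_or_nonempty with h | ⟨z, hz⟩
    · have := hZq q
      rw [h, nEuler, negEuler_empty] at this
      exact absurd (by exact_mod_cast this.symm) hq
    · exact Finset.mem_image.2 ⟨z, hsub q hz, hπ q z hz⟩
  have hsum : ∀ Q' : Finset (Quotient (dcSetoid H1 H2)), Q ⊆ Q' →
      (rrkInter H1 H2 : ℤ) = ∑ q ∈ Q', (rrk (H1 ⊓ conjS q.out H2) : ℤ) := by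
    intro Q' hQ'
    unfold rrkInter
    rw [finsum_eq_sum_of_support_subset (s := Q') _ (fun q hq => hQ' (hsupp q hq))]
    push_cast
    rfl
  constructor
  · refine ⟨Q.biUnion Zq, Finset.biUnion_subset.2 fun q _ => hsub q, ?_⟩
    rw [nEuler, negEuler_eq_sum_fibers (pairCoset H1 H2) pairCoset_smul _ Q, hsum Q subset_rfl]
    · refine Finset.sum_congr rfl fun q hq => ?_
      rw [← hZq q]
      congr 1
      ext z
      simp only [Finset.mem_filter, Finset.mem_biUnion]
      constructor
      · rintro ⟨⟨p, hp, hz⟩, e⟩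
        rwa [← e, hπ p z hz]
      · intro hz
        exact ⟨⟨q, hq, hz⟩, hπ q z hz⟩
    · intro z hz
      obtain ⟨q, hq, hz⟩ := Finset.mem_biUnion.1 hz
      rwa [hπ q z hz]
  · intro Z
    rw [nEuler, negEuler_eq_sum_fibers (pairCoset H1 H2) pairCoset_smul Z
      (Q ∪ Z.image (pairCoset H1 H2)) (fun z hz => Finset.mem_union_right _
        (Finset.mem_image_of_mem _ hz)), hsum _ Finset.subset_union_left]
    exact Finset.sum_le_sum fun q _ => hle q _ fun z hz => by
      simp only [Finset.mem_filter] at hz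
      exact hz.2

end GeneralizedIntersection

section RatioMaximum

/-- The value of a linear form with coefficients `w` at a vector of natural numbers. -/
def weight {ι : Type} [Fintype ι] (w : ι → ℚ) (x : ι → ℕ) : ℚ := ∑ i, (x i : ℚ) * w i

theorem weight_add {ι : Type} [Fintype ι] (w : ι → ℚ) (x y : ι → ℕ) :
    weight w (x + y) = weight w x + weight w y := by
  simp [weight, add_mul, Finset.sum_add_distrib]

/-- On a set of natural vectors closed under subtraction, the ratio of two linear forms attains its
maximum if the first form is nonpositive wherever the (nonnegative) second one vanishes. -/
theorem exists_maximal_ratio {ι : Type} [Fintype ι] (wN wD : ι → ℚ) (M : Set (ι → ℕ))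
    (hsub : ∀ x ∈ M, ∀ y ∈ M, x ≤ y → y - x ∈ M)
    (hD : ∀ x ∈ M, 0 ≤ weight wD x) (hN : ∀ x ∈ M, weight wD x = 0 → weight wN x ≤ 0)
    (hM : ∃ x ∈ M, 0 < weight wD x) :
    ∃ y ∈ M, 0 < weight wD y ∧
      ∀ x ∈ M, weight wN x * weight wD y ≤ weight wN y * weight wD x := by
  classical
  have hfin : {x | Minimal (fun x => x ∈ M ∧ x ≠ 0) x}.Finite := by
    have hanti : IsAntichain (· ≤ ·) {x | Minimal (fun x => x ∈ M ∧ x ≠ 0) x} :=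
      setOfPred_minimal_antichain _
    exact hanti.finite_of_partiallyWellOrderedOn (Set.isPWO_of_wellQuasiOrderedLE _)
  have key : ∀ (P : (ι → ℕ) → Prop), (∀ x ∈ M, x ≠ 0 → (Minimal (fun x => x ∈ M ∧ x ≠ 0) x → P x)) →
      P 0 → (∀ x ∈ M, ∀ y ∈ M, P x → P y → P (x + y)) → ∀ x ∈ M, P x := by
    intro P hmin h0 hadd x
    induction x using WellFoundedLT.induction with
    | ind x ih =>
    intro hx
    by_cases hx0 : x = 0
    · rwa [hx0]
    obtain ⟨m, hmx, hm⟩ := exists_minimal_le_of_wellFoundedLT (fun x => x ∈ M ∧ x ≠ 0) x ⟨hx, hx0⟩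
    have hPm : P m := hmin m hm.prop.1 hm.prop.2 hm
    have hadd' : m + (x - m) = x := add_tsub_cancel_of_le hmx
    have hlt : x - m < x := by
      refine lt_of_le_of_ne tsub_le_self fun h => hm.prop.2 ?_
      funext i
      have h1 := congrFun h i
      have h2 := hmx i
      simp only [Pi.sub_apply] at h1
      simp only [Pi.zero_apply]
      lia
    have hM' := hsub m hm.prop.1 x hx hmx
    rw [← hadd']
    exact hadd m hm.prop.1 _ hM' hPm (ih _ hlt hM')
  obtain ⟨x₀, hx₀, hpos⟩ := hM
  have hne : ∃ m, Minimal (fun x => x ∈ M ∧ x ≠ 0) m ∧ 0 < weight wD m := by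
    by_contra! hcon
    refine hpos.not_ge (key (fun x => weight wD x ≤ 0) (fun x _ _ h => hcon x h)
      (by simp [weight]) (fun x _ y _ hx hy => ?_) x₀ hx₀)
    simp only [weight_add]
    linarith
  obtain ⟨m₀, hm₀, hm₀'⟩ := hne
  obtain ⟨y, hy, hmax⟩ := Finset.exists_max_image
    (hfin.toFinset.filter fun x => 0 < weight wD x) (fun x => weight wN x / weight wD x)
    ⟨m₀, by simp [hm₀, hm₀']⟩
  simp only [Finset.mem_filter, Set.Finite.mem_toFinset, Set.mem_ofPred_eq] at hy hmax
  refine ⟨y, hy.1.prop.1, hy.2, key _ (fun x hx _ hmin => ?_) (by simp [weight]) ?_⟩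
  · rcases (hD x hx).lt_or_eq with h | h
    · have := hmax x ⟨hmin, h⟩
      rwa [div_le_div_iff₀ h hy.2] at this
    · rw [← h, mul_zero]
      exact mul_nonpos_of_nonpos_of_nonneg (hN x hx h.symm) hy.2.le
  · intro x _ x' _ h h'
    rw [weight_add, weight_add]
    linarith

end RatioMaximum

section LocalTypes

open scoped Classical

variable {F G X₁ L : Type} [Group F] [Group G] [Fintype G] [MulAction F X₁] (j : G →* F)
  (car : L → Finset X₁)

/-- The fibre prescribed by an optional label. -/
def fibre : Option L → Finset X₁
  | none => ∅
  | some l => car l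

/-- The number of labelled elements of a labelled torsor. -/
noncomputable def typeDeg (t : G → Option L) : ℕ := (Finset.univ.filter fun g => t g ≠ none).card

/-- The contribution of one factor at a labelled torsor to the negated Euler characteristic
of the set of labelled points. -/
noncomputable def typeWeight (t : G → Option L) : ℚ :=
  ∑ g with t g ≠ none, (1 / 2 - 1 / (typeDeg t : ℚ))

/-- The number of points of the fibres over a labelled torsor in the orbit of a given one. -/
noncomputable def pairDeg (t : G → Option L) (g : G) (x : X₁) : ℕ :=
  (Finset.univ.filter fun h => j h • x ∈ fibre car (t (h * g))).card

/-- The contribution of one factor at a labelled torsor to the negated Euler characteristic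
of the set of points of the fibres. -/
noncomputable def pairWeight (t : G → Option L) : ℚ :=
  ∑ g, ∑ x ∈ fibre car (t g), (1 / 2 - 1 / (pairDeg j car t g x : ℚ))

/-- The number of points with a given label. -/
noncomputable def labelCount (t : G → Option L) (l : L) : ℕ :=
  (Finset.univ.filter fun g => t g = some l).card

omit [Group G] in
theorem typeWeight_eq {t : G → Option L} (ht : typeDeg t ≠ 0) :
    typeWeight t = typeDeg t / 2 - 1 := by
  have : (typeDeg t : ℚ) ≠ 0 := by exact_mod_cast ht
  unfold typeWeight
  rw [Finset.sum_const, nsmul_eq_mul]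
  change (typeDeg t : ℚ) * _ = _
  field_simp

theorem pairWeight_nonpos {t : G → Option L} (ht : typeDeg t ≤ 2) : pairWeight j car t ≤ 0 := by
  refine Finset.sum_nonpos fun g _ => Finset.sum_nonpos fun x hx => ?_
  have h1 : 0 < pairDeg j car t g x :=
    Finset.card_pos.2 ⟨1, by simpa using hx⟩
  have h2 : pairDeg j car t g x ≤ 2 := by
    refine le_trans (Finset.card_le_card_of_injOn (· * g) ?_
      (mul_left_injective g).injOn) ht
    intro h hh
    simp only [Finset.coe_filter, Finset.mem_univ, true_and] at hh ⊢
    intro hn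
    change j h • x ∈ fibre car (t (h * g)) at hh
    rw [show t (h * g) = none from hn] at hh
    simp [fibre] at hh
  have h3 : (0 : ℚ) < pairDeg j car t g x := by exact_mod_cast h1
  have h4 : (pairDeg j car t g x : ℚ) ≤ 2 := by exact_mod_cast h2
  have := one_div_le_one_div_of_le h3 h4
  linarith

variable {X V : Type} [MulAction F X] {j} {car}

theorem sum_eq_sum_base {b : V → X}
    (hb : Function.Bijective fun p : V × G => j p.2 • b p.1) (Y : Finset X) (V₀ : Finset V)
    (hV₀ : ∀ v g, j g • b v ∈ Y → v ∈ V₀) {A : Type} [AddCommMonoid A] (φ : X → A) :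
    ∑ y ∈ Y, φ y = ∑ v ∈ V₀, ∑ g, if j g • b v ∈ Y then φ (j g • b v) else 0 := by
  rw [← Finset.sum_product', ← Finset.sum_filter]
  refine (Finset.sum_bij (fun p _ => j p.2 • b p.1) ?_ ?_ ?_ ?_).symm
  · intro p hp
    exact (Finset.mem_filter.1 hp).2
  · intro p _ p' _ h
    exact hb.1 h
  · intro y hy
    obtain ⟨p, rfl⟩ := hb.2 y
    exact ⟨p, Finset.mem_filter.2 ⟨Finset.mem_product.2 ⟨hV₀ _ _ hy, Finset.mem_univ _⟩, hy⟩, rfl⟩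
  · intro p _
    rfl

theorem card_filter_mul_right (p : G → Prop) (g : G) :
    (Finset.univ.filter fun h => p (h * g)).card = (Finset.univ.filter p).card := by
  refine Finset.card_bij (fun h _ => h * g) ?_ (fun _ _ _ _ h => mul_left_injective g h) ?_
  · intro h hh
    simpa using hh
  · intro h hh
    exact ⟨h * g⁻¹, by simpa using hh, by simp⟩

variable (j) in
/-- The contribution of one factor to the negated Euler characteristic. -/
noncomputable def halfEuler {W : Type} [MulAction F W] (Z : Finset W) : ℚ :=
  (Z.card : ℚ) / 2 - orbCount j Z

theorem halfEuler_eq_sum {W : Type} [MulAction F W] (hW : ActsFreely j W) (Z : Finset W) :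
    halfEuler j Z =
      ∑ z ∈ Z, (1 / 2 - 1 / ((Finset.univ.filter fun g : G => j g • z ∈ Z).card : ℚ)) := by
  rw [halfEuler, orbCount_eq_sum hW, Finset.sum_sub_distrib, Finset.sum_const, nsmul_eq_mul]
  ring

omit [Fintype G] in
theorem negEuler_eq_halfEuler_add {G' W : Type} [Group G'] [MulAction F W] (j' : G' →* F)
    (Z : Finset W) : (negEuler j j' Z : ℚ) = halfEuler j Z + halfEuler j' Z := by
  unfold negEuler halfEuler
  push_cast
  ring

section Labelled

variable (hX : ActsFreely j X) {b : V → X}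
  (hb : Function.Bijective fun p : V × G => j p.2 • b p.1) {Y : Finset X} {ℓ : X → Option L}
  (hY : ∀ x, x ∈ Y ↔ ℓ x ≠ none) {V₀ : Finset V} (hV₀ : ∀ v g, j g • b v ∈ Y → v ∈ V₀)

include hX hb hY hV₀

theorem halfEuler_eq_sum_typeWeight :
    halfEuler j Y = ∑ v ∈ V₀, typeWeight fun g => ℓ (j g • b v) := by
  rw [halfEuler_eq_sum hX, sum_eq_sum_base hb Y V₀ hV₀]
  refine Finset.sum_congr rfl fun v _ => ?_
  rw [typeWeight, Finset.sum_filter]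
  refine Finset.sum_congr rfl fun g _ => ?_
  simp only [hY]
  refine if_congr Iff.rfl ?_ rfl
  have e := congrArg (fun n : ℕ => (1 / 2 - 1 / (n : ℚ)))
    (card_filter_mul_right (fun g => ℓ (j g • b v) ≠ none) g)
  simp only [map_mul, mul_smul] at e
  convert e
  unfold typeDeg
  congr

theorem halfEuler_eq_sum_pairWeight {Z : Finset (X₁ × X)}
    (hZ : ∀ x₁ x, (x₁, x) ∈ Z ↔ x₁ ∈ fibre car (ℓ x)) :
    halfEuler j Z = ∑ v ∈ V₀, pairWeight j car fun g => ℓ (j g • b v) := by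
  have hW : ActsFreely j (X₁ × X) := fun g w h => hX g w.2 (congrArg Prod.snd h)
  have hZY : ∀ z ∈ Z, z.2 ∈ Y := by
    rintro ⟨x₁, x⟩ hz
    rw [hY]
    intro hn
    have := (hZ x₁ x).1 hz
    change ℓ x = none at hn
    rw [hn] at this
    simp [fibre] at this
  rw [halfEuler_eq_sum hW, ← Finset.sum_fiberwise_of_maps_to hZY, sum_eq_sum_base hb Y V₀ hV₀]
  refine Finset.sum_congr rfl fun v _ => ?_
  rw [pairWeight]
  refine Finset.sum_congr rfl fun g _ => ?_
  have hsum : ∑ z ∈ Z with z.2 = j g • b v,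
      (1 / 2 - 1 / ((Finset.univ.filter fun h : G => j h • z ∈ Z).card : ℚ)) =
      ∑ x ∈ fibre car (ℓ (j g • b v)),
        (1 / 2 - 1 / (pairDeg j car (fun g => ℓ (j g • b v)) g x : ℚ)) := by
    refine Finset.sum_bij' (fun z _ => z.1) (fun x _ => (x, j g • b v)) ?_ ?_ ?_ ?_ ?_
    · rintro ⟨x₁, x⟩ hz
      obtain ⟨hz, rfl⟩ := Finset.mem_filter.1 hz
      exact (hZ _ _).1 hz
    · intro x hx
      exact Finset.mem_filter.2 ⟨(hZ _ _).2 hx, rfl⟩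
    · rintro ⟨x₁, x⟩ hz
      obtain ⟨hz, rfl⟩ := Finset.mem_filter.1 hz
      rfl
    · intro x hx
      rfl
    · rintro ⟨x₁, x⟩ hz
      obtain ⟨hz, rfl⟩ := Finset.mem_filter.1 hz
      congr 3
      unfold pairDeg
      congr 1
      ext h
      simp only [Finset.mem_filter, Finset.mem_univ, true_and, Prod.smul_mk, hZ, map_mul, mul_smul]
  split_ifs with h
  · convert hsum
  · refine Eq.trans ?_ hsum
    refine (Finset.sum_eq_zero fun z hz => ?_).symm
    obtain ⟨hz, e⟩ := Finset.mem_filter.1 hz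
    exact absurd (e ▸ hZY z hz) h

omit hX in
theorem card_filter_eq_sum_labelCount (l : L) :
    (Y.filter fun x => ℓ x = some l).card = ∑ v ∈ V₀, labelCount (fun g => ℓ (j g • b v)) l := by
  rw [Finset.card_filter, sum_eq_sum_base hb Y V₀ hV₀]
  refine Finset.sum_congr rfl fun v _ => ?_
  rw [labelCount, Finset.card_filter]
  refine Finset.sum_congr rfl fun g _ => ?_
  simp only [hY]
  split_ifs <;> simp_all

omit hX hb hV₀ in
theorem two_le_typeDeg (hleaf : ∀ y ∈ Y, ∃ g, g ≠ 1 ∧ j g • y ∈ Y) {v : V} {g : G}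
    (hv : j g • b v ∈ Y) : 2 ≤ typeDeg fun g => ℓ (j g • b v) := by
  obtain ⟨g', hg', h⟩ := hleaf _ hv
  refine Finset.one_lt_card.2 ⟨g, by simpa [← hY] using hv, g' * g, ?_, ?_⟩
  · simpa [← hY, mul_smul] using h
  · simpa using hg'

end Labelled

variable (j) in
omit [Fintype G] in
theorem exists_base (hX : ActsFreely j X) :
    ∃ (V : Type) (b : V → X), Function.Bijective fun p : V × G => j p.2 • b p.1 := by
  refine ⟨Set.range (orb j : X → Set X), fun v => v.2.choose, ?_, ?_⟩
  · rintro ⟨v, g⟩ ⟨v', g'⟩ h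
    change j g • v.2.choose = j g' • v'.2.choose at h
    have hv : orb j v.2.choose = orb j v'.2.choose :=
      orb_eq_iff.2 ⟨g'⁻¹ * g, by rw [map_mul, mul_smul, h, map_inv, inv_smul_smul]⟩
    rw [v.2.choose_spec, v'.2.choose_spec] at hv
    obtain rfl := Subtype.ext hv
    have : g'⁻¹ * g = 1 := hX _ v.2.choose (by rw [map_mul, mul_smul, h, map_inv, inv_smul_smul])
    rw [inv_mul_eq_one.1 this]
  · intro x
    have hx := (⟨orb j x, x, rfl⟩ : Set.range (orb j : X → Set X)).2.choose_spec
    obtain ⟨g, hg⟩ := orb_eq_iff.1 hx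
    exact ⟨(⟨orb j x, x, rfl⟩, g), hg⟩

theorem sum_eq_sum_card_mul {T : Type} [Fintype T] (V₀ : Finset V) (τ : V → T) (w : T → ℚ) :
    ∑ v ∈ V₀, w (τ v) = ∑ t, ((V₀.filter fun v => τ v = t).card : ℚ) * w t := by
  rw [← Finset.sum_fiberwise_of_maps_to (g := τ) (t := Finset.univ) (fun _ _ => Finset.mem_univ _)]
  refine Finset.sum_congr rfl fun t _ => ?_
  rw [Finset.sum_congr rfl (g := fun _ => w t), Finset.sum_const, nsmul_eq_mul]
  intro v hv
  rw [(Finset.mem_filter.1 hv).2]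

end LocalTypes

section TypeCounts

open scoped Classical

variable {F G X₁ L X V : Type} [Group F] [Group G] [Fintype G] [Fintype L] [MulAction F X₁]
  [MulAction F X] {j : G →* F} {car : L → Finset X₁}

theorem weight_card_types (hX : ActsFreely j X) {b : V → X}
    (hb : Function.Bijective fun p : V × G => j p.2 • b p.1) {Y : Finset X} {ℓ : X → Option L}
    (hY : ∀ x, x ∈ Y ↔ ℓ x ≠ none) {V₀ : Finset V} (hV₀ : ∀ v g, j g • b v ∈ Y → v ∈ V₀)
    {Z : Finset (X₁ × X)} (hZ : ∀ x₁ x, (x₁, x) ∈ Z ↔ x₁ ∈ fibre car (ℓ x))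
    {c : (G → Option L) → ℕ}
    (hc : ∀ t, c t = (V₀.filter fun v => (fun g => ℓ (j g • b v)) = t).card) :
    weight typeWeight c = halfEuler j Y ∧ weight (pairWeight j car) c = halfEuler j Z ∧
      ∀ l, ∑ t, c t * labelCount t l = (Y.filter fun x => ℓ x = some l).card := by
  refine ⟨?_, ?_, fun l => ?_⟩
  · rw [halfEuler_eq_sum_typeWeight hX hb hY hV₀,
      sum_eq_sum_card_mul V₀ (fun v g => ℓ (j g • b v)) typeWeight]
    exact Finset.sum_congr rfl fun t _ => by rw [hc]; congr
  · rw [halfEuler_eq_sum_pairWeight hX hb hY hV₀ hZ,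
      sum_eq_sum_card_mul V₀ (fun v g => ℓ (j g • b v)) (pairWeight j car)]
    exact Finset.sum_congr rfl fun t _ => by rw [hc]; congr
  · have h := sum_eq_sum_card_mul V₀ (fun v g => ℓ (j g • b v)) fun t => (labelCount t l : ℚ)
    have h' : ∑ t, (c t : ℚ) * (labelCount t l : ℚ) =
        ∑ v ∈ V₀, (labelCount (fun g => ℓ (j g • b v)) l : ℚ) :=
      (h.trans (Finset.sum_congr rfl fun t _ => by rw [hc]; congr)).symm
    rw [card_filter_eq_sum_labelCount hb hY hV₀]
    exact_mod_cast h'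

theorem exists_type_count (hX : ActsFreely j X) {Y : Finset X} {ℓ : X → Option L}
    (hY : ∀ x, x ∈ Y ↔ ℓ x ≠ none) (hleaf : ∀ y ∈ Y, ∃ g, g ≠ 1 ∧ j g • y ∈ Y)
    {Z : Finset (X₁ × X)} (hZ : ∀ x₁ x, (x₁, x) ∈ Z ↔ x₁ ∈ fibre car (ℓ x)) :
    ∃ c : (G → Option L) → ℕ, (∀ t, c t ≠ 0 → 2 ≤ typeDeg t) ∧
      weight typeWeight c = halfEuler j Y ∧ weight (pairWeight j car) c = halfEuler j Z ∧
      ∀ l, ∑ t, c t * labelCount t l = (Y.filter fun x => ℓ x = some l).card := by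
  obtain ⟨V, b, hb⟩ := exists_base j hX
  let e := Equiv.ofBijective _ hb
  have he : ∀ v g, (e.symm (j g • b v)).1 = v := fun v g =>
    congrArg Prod.fst (e.symm_apply_apply (v, g))
  refine ⟨_, fun t ht => ?_, weight_card_types hX hb hY (V₀ := Y.image fun y => (e.symm y).1)
    (fun v g h => Finset.mem_image.2 ⟨_, h, he v g⟩) hZ fun t => rfl⟩
  obtain ⟨v, hv⟩ := Finset.card_ne_zero.1 ht
  simp only [Finset.mem_filter, Finset.mem_image] at hv
  obtain ⟨⟨y, hy, rfl⟩, rfl⟩ := hv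
  have : j (e.symm y).2 • b (e.symm y).1 = y := e.apply_symm_apply y
  exact two_le_typeDeg hY hleaf (this.symm ▸ hy)

/-- The labelling of a disjoint union of torsors with prescribed numbers of labelled torsors of each
type and infinitely many torsors without labels. -/
def torsorLabel (c : (G → Option L) → ℕ) : ((Σ t, Fin (c t)) ⊕ ℕ) × G → Option L
  | (Sum.inl s, g) => s.1 g
  | (Sum.inr _, _) => none

omit [Group G] in
theorem card_torsorLabel_eq_some (c : (G → Option L) → ℕ) (l : L) :
    Nat.card {p // torsorLabel c p = some l} = ∑ t, c t * labelCount t l := by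
  have e : (Σ s : Σ t, Fin (c t), {g : G // s.1 g = some l}) ≃ {p // torsorLabel c p = some l} :=
    Equiv.ofBijective (fun q => ⟨(Sum.inl q.1, q.2.1), q.2.2⟩) (by
      constructor
      · rintro ⟨s, g, hg⟩ ⟨s', g', hg'⟩ h
        replace h := congrArg Subtype.val h
        simp only [Prod.mk.injEq, Sum.inl.injEq] at h
        obtain ⟨rfl, rfl⟩ := h
        rfl
      · rintro ⟨⟨s | n, g⟩, h⟩
        · exact ⟨⟨s, g, h⟩, rfl⟩
        · simp [torsorLabel] at h)
  rw [← Nat.card_congr e, Nat.card_eq_fintype_card, Fintype.card_sigma, Fintype.sum_sigma]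
  refine Finset.sum_congr rfl fun t _ => ?_
  simp [labelCount, Fintype.card_subtype]

omit [Fintype G] [Fintype L] in
theorem infinite_torsorLabel_eq_none (c : (G → Option L) → ℕ) :
    Infinite {p // torsorLabel c p = none} :=
  Infinite.of_injective (fun n : ℕ => ⟨(Sum.inr n, 1), rfl⟩) fun n m h => by
    simpa using congrArg Subtype.val h

theorem exists_torsorLabel_equiv {G' : Type} [Group G'] [Fintype G'] (c : (G → Option L) → ℕ)
    (c' : (G' → Option L) → ℕ)
    (h : ∀ l, ∑ t, c t * labelCount t l = ∑ t, c' t * labelCount t l) :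
    ∃ θ : ((Σ t, Fin (c t)) ⊕ ℕ) × G ≃ ((Σ t, Fin (c' t)) ⊕ ℕ) × G',
      ∀ p, torsorLabel c' (θ p) = torsorLabel c p := by
  have hfib : ∀ o, Nonempty ({p // torsorLabel c p = o} ≃ {p // torsorLabel c' p = o}) := by
    rintro (_ | l)
    · have := infinite_torsorLabel_eq_none c
      have := infinite_torsorLabel_eq_none c'
      exact nonempty_equiv_of_countable
    · have hfin : ∀ {G : Type} [Group G] [Fintype G] (c : (G → Option L) → ℕ),
          Finite {p // torsorLabel c p = some l} := by
        intro G _ _ c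
        refine Finite.of_surjective
          (fun q : {q : (Σ t, Fin (c t)) × G // torsorLabel c (Sum.inl q.1, q.2) = some l} =>
            (⟨(Sum.inl q.1.1, q.1.2), q.2⟩ : {p // torsorLabel c p = some l})) ?_
        rintro ⟨⟨s | n, g⟩, h⟩
        · exact ⟨⟨(s, g), h⟩, rfl⟩
        · simp [torsorLabel] at h
      have := hfin c
      have := hfin c'
      refine Finite.card_eq.1 ?_
      rw [card_torsorLabel_eq_some, card_torsorLabel_eq_some, h]
  exact ⟨Equiv.ofFiberEquiv fun o => (hfib o).some, fun p => Equiv.ofFiberEquiv_map _ p⟩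

/-- The action of `G` on a disjoint union of copies of `G` by left multiplication. -/
def torsorPerm (V G : Type) [Group G] : G →* Equiv.Perm (V × G) where
  toFun g := (Equiv.refl V).prodCongr (Equiv.mulLeft g)
  map_one' := by ext <;> simp
  map_mul' g h := by ext <;> simp [mul_assoc]

section Realization

variable {c : (G → Option L) → ℕ} {e : ((Σ t, Fin (c t)) ⊕ ℕ) × G ≃ X}
  (he : ∀ g v h, j g • e (v, h) = e (v, g * h)) {ℓ : X → Option L}
  (hℓ : ∀ p, ℓ (e p) = torsorLabel c p)

include he

omit [Fintype G] [Fintype L] in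
theorem actsFreely_of_torsor : ActsFreely j X := by
  intro g x hx
  obtain ⟨⟨v, h⟩, rfl⟩ := e.surjective x
  rw [he] at hx
  simpa using e.injective hx

include hℓ

theorem weight_of_torsor {Y : Finset X} (hY : ∀ x, x ∈ Y ↔ ℓ x ≠ none) {Z : Finset (X₁ × X)}
    (hZ : ∀ x₁ x, (x₁, x) ∈ Z ↔ x₁ ∈ fibre car (ℓ x)) :
    weight typeWeight c = halfEuler j Y ∧ weight (pairWeight j car) c = halfEuler j Z := by
  have hb : (fun p : ((Σ t, Fin (c t)) ⊕ ℕ) × G => j p.2 • e (p.1, 1)) = e := by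
    funext p
    rw [he, mul_one]
  have htype : ∀ s g, ℓ (j g • e (Sum.inl s, 1)) = s.1 g := by
    intro s g
    rw [he, mul_one, hℓ]
    rfl
  have h := weight_card_types (car := car) (c := c) (actsFreely_of_torsor he)
    (b := fun v => e (v, 1)) (by simpa only [hb] using e.bijective) hY
    (V₀ := Finset.univ.map ⟨Sum.inl, Sum.inl_injective⟩) ?_ hZ ?_
  · exact ⟨h.1, h.2.1⟩
  · rintro (s | n) g h
    · simp
    · rw [he, hY, hℓ] at h
      exact absurd rfl h
  · intro t
    rw [Finset.filter_map, Finset.card_map]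
    have : ∀ s : Σ t, Fin (c t), ((fun v => (fun g => ℓ (j g • e (v, 1))) = t) ∘
        (⟨Sum.inl, Sum.inl_injective⟩ : (Σ t, Fin (c t)) ↪ (Σ t, Fin (c t)) ⊕ ℕ)) s ↔ s.1 = t := by
      intro s
      simp only [Function.comp, Function.Embedding.coeFn_mk, htype]
    conv_lhs => rw [← Finset.card_fin (c t),
      ← Finset.card_map (Function.Embedding.sigmaMk (β := fun t => Fin (c t)) t)]
    congr 1
    ext ⟨t', i⟩
    simp only [Finset.mem_filter, this, Finset.mem_map, Finset.mem_univ, true_and]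
    constructor
    · rintro ⟨i', h⟩
      exact (congrArg Sigma.fst h).symm
    · rintro rfl
      exact ⟨i, rfl⟩

omit [Fintype L] in
theorem leafless_of_torsor (hc : ∀ t, c t ≠ 0 → 2 ≤ typeDeg t) {Y : Finset X}
    (hY : ∀ x, x ∈ Y ↔ ℓ x ≠ none) : ∀ y ∈ Y, ∃ g, g ≠ 1 ∧ j g • y ∈ Y := by
  intro y hy
  obtain ⟨⟨s | n, g⟩, rfl⟩ := e.surjective y
  · have h2 := hc s.1 (by have := s.2.2; lia)
    obtain ⟨g', hg', hne⟩ := Finset.exists_mem_ne (lt_of_lt_of_le one_lt_two h2) g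
    refine ⟨g' * g⁻¹, ?_, ?_⟩
    · rwa [Ne, mul_inv_eq_one]
    · rw [he, inv_mul_cancel_right, hY, hℓ]
      exact (Finset.mem_filter.1 hg').2
  · rw [hY, hℓ] at hy
    exact absurd rfl hy

end Realization

end TypeCounts

section Systems

open scoped Classical

variable {G1 G2 X₁ : Type} [Group G1] [Group G2] [MulAction (Coprod G1 G2) X₁]

variable (G1 G2) in
/-- A finite leafless subset `Y` of a `G1 ∗ G2`-set on which the factors act freely, together with
a subset of `Y₁ × Y`. -/
structure IsSystem (Y₁ : Finset X₁) {X : Type} [MulAction (Coprod G1 G2) X] (Y : Finset X)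
    (Z : Finset (X₁ × X)) : Prop where
  free : FactorsFree G1 G2 X
  left : ∀ y ∈ Y, ∃ g : G1, g ≠ 1 ∧ (Coprod.inl g : Coprod G1 G2) • y ∈ Y
  right : ∀ y ∈ Y, ∃ g : G2, g ≠ 1 ∧ (Coprod.inr g : Coprod G1 G2) • y ∈ Y
  subset : Z ⊆ Y₁ ×ˢ Y

/-- The vectors counting the local types of a system: every label has to occur equally often for
both factors, and all types have at least two labels. -/
def typeVectors (G1 G2 L : Type) [Fintype G1] [Fintype G2] [Fintype L] :
    Set ((G1 → Option L) ⊕ (G2 → Option L) → ℕ) :=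
  {c | (∀ l, ∑ t, c (Sum.inl t) * labelCount t l = ∑ t, c (Sum.inr t) * labelCount t l) ∧
    (∀ t, c (Sum.inl t) ≠ 0 → 2 ≤ typeDeg t) ∧ ∀ t, c (Sum.inr t) ≠ 0 → 2 ≤ typeDeg t}

theorem weight_sum {ι κ : Type} [Fintype ι] [Fintype κ] (w : ι ⊕ κ → ℚ) (c : ι ⊕ κ → ℕ) :
    weight w c = weight (w ∘ Sum.inl) (c ∘ Sum.inl) + weight (w ∘ Sum.inr) (c ∘ Sum.inr) :=
  Fintype.sum_sum_type _

section TypeVectors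

variable [Fintype G1] [Fintype G2] {L : Type} [Fintype L] {car : L → Finset X₁}

variable (G1 G2 L) in
/-- The contributions of the local types to the negated Euler characteristic of `Y`. -/
noncomputable def denWeight : (G1 → Option L) ⊕ (G2 → Option L) → ℚ :=
  Sum.elim typeWeight typeWeight

variable (G1 G2 car) in
/-- The contributions of the local types to the negated Euler characteristic of `Z`. -/
noncomputable def numWeight : (G1 → Option L) ⊕ (G2 → Option L) → ℚ :=
  Sum.elim (pairWeight (Coprod.inl : G1 →* Coprod G1 G2) car)
    (pairWeight (Coprod.inr : G2 →* Coprod G1 G2) car)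

omit [Group G1] [Group G2] in
theorem sub_mem_typeVectors {c c' : (G1 → Option L) ⊕ (G2 → Option L) → ℕ}
    (hc : c ∈ typeVectors G1 G2 L) (hc' : c' ∈ typeVectors G1 G2 L) (h : c ≤ c') :
    c' - c ∈ typeVectors G1 G2 L := by
  refine ⟨fun l => ?_, fun t ht => hc'.2.1 t fun h0 => ht (by simp [h0]),
    fun t ht => hc'.2.2 t fun h0 => ht (by simp [h0])⟩
  have e1 := hc.1 l
  have e2 := hc'.1 l
  obtain ⟨d, rfl⟩ := exists_add_of_le h
  simp only [Pi.add_apply, add_mul, Finset.sum_add_distrib] at e2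
  simp only [add_tsub_cancel_left]
  lia

theorem typeDeg_of_mem_typeVectors {c : (G1 → Option L) ⊕ (G2 → Option L) → ℕ}
    (hc : c ∈ typeVectors G1 G2 L) (i : (G1 → Option L) ⊕ (G2 → Option L)) (hi : c i ≠ 0) :
    0 ≤ denWeight G1 G2 L i ∧ (denWeight G1 G2 L i = 0 → numWeight G1 G2 car i ≤ 0) := by
  rcases i with t | t
  · have h := hc.2.1 t hi
    have h' : (2 : ℚ) ≤ typeDeg t := by exact_mod_cast h
    simp only [denWeight, numWeight, Sum.elim_inl, typeWeight_eq (show typeDeg t ≠ 0 by lia)]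
    refine ⟨by linarith, fun h0 => pairWeight_nonpos _ _ ?_⟩
    have : (typeDeg t : ℚ) ≤ 2 := by linarith
    exact_mod_cast this
  · have h := hc.2.2 t hi
    have h' : (2 : ℚ) ≤ typeDeg t := by exact_mod_cast h
    simp only [denWeight, numWeight, Sum.elim_inr, typeWeight_eq (show typeDeg t ≠ 0 by lia)]
    refine ⟨by linarith, fun h0 => pairWeight_nonpos _ _ ?_⟩
    have : (typeDeg t : ℚ) ≤ 2 := by linarith
    exact_mod_cast this

theorem denWeight_nonneg {c : (G1 → Option L) ⊕ (G2 → Option L) → ℕ}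
    (hc : c ∈ typeVectors G1 G2 L) (i : (G1 → Option L) ⊕ (G2 → Option L)) :
    0 ≤ (c i : ℚ) * denWeight G1 G2 L i := by
  by_cases hi : c i = 0
  · simp [hi]
  · exact mul_nonneg (Nat.cast_nonneg _)
      (typeDeg_of_mem_typeVectors (X₁ := Coprod G1 G2) (car := fun _ => ∅) hc i hi).1

theorem numWeight_nonpos {c : (G1 → Option L) ⊕ (G2 → Option L) → ℕ}
    (hc : c ∈ typeVectors G1 G2 L) (h : weight (denWeight G1 G2 L) c = 0) :
    weight (numWeight G1 G2 car) c ≤ 0 := by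
  have h' := (Finset.sum_eq_zero_iff_of_nonneg fun i _ => denWeight_nonneg hc i).1 h
  refine Finset.sum_nonpos fun i hi => ?_
  by_cases hci : c i = 0
  · simp [hci]
  · refine mul_nonpos_of_nonneg_of_nonpos (Nat.cast_nonneg _)
      ((typeDeg_of_mem_typeVectors hc i hci).2 ?_)
    exact (mul_eq_zero.1 (h' i hi)).resolve_left (by exact_mod_cast hci)

theorem exists_typeVector {X : Type} [MulAction (Coprod G1 G2) X] {Y : Finset X}
    {Z : Finset (X₁ × X)} {Y₁ : Finset X₁} (h : IsSystem G1 G2 Y₁ Y Z) {ℓ : X → Option L}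
    (hY : ∀ x, x ∈ Y ↔ ℓ x ≠ none) (hZ : ∀ x₁ x, (x₁, x) ∈ Z ↔ x₁ ∈ fibre car (ℓ x)) :
    ∃ c ∈ typeVectors G1 G2 L, weight (denWeight G1 G2 L) c = nEuler G1 G2 Y ∧
      weight (numWeight G1 G2 car) c = nEuler G1 G2 Z := by
  obtain ⟨c, h1, h2, h3, h4⟩ := exists_type_count h.free.1 hY h.left hZ
  obtain ⟨c', h1', h2', h3', h4'⟩ := exists_type_count h.free.2 hY h.right hZ
  refine ⟨Sum.elim c c', ⟨fun l => (h4 l).trans (h4' l).symm, h1, h1'⟩, ?_, ?_⟩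
  · rw [weight_sum, negEuler_eq_halfEuler_add, ← h2, ← h2']
    rfl
  · rw [weight_sum, negEuler_eq_halfEuler_add, ← h3, ← h3']
    rfl

theorem exists_system_of_typeVector {Y₁ : Finset X₁} (hcar : ∀ l, car l ⊆ Y₁)
    {c : (G1 → Option L) ⊕ (G2 → Option L) → ℕ} (hc : c ∈ typeVectors G1 G2 L) :
    ∃ (X : Type) (_ : MulAction (Coprod G1 G2) X) (Y : Finset X) (Z : Finset (X₁ × X)),
      IsSystem G1 G2 Y₁ Y Z ∧ weight (denWeight G1 G2 L) c = nEuler G1 G2 Y ∧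
      weight (numWeight G1 G2 car) c = nEuler G1 G2 Z := by
  obtain ⟨θ, hθ⟩ := exists_torsorLabel_equiv (c ∘ Sum.inl) (c ∘ Sum.inr) hc.1
  let X := ((Σ t, Fin ((c ∘ Sum.inl) t)) ⊕ ℕ) × G1
  let ρ : Coprod G1 G2 →* Equiv.Perm X := Coprod.lift (torsorPerm _ G1)
    (θ.symm.permCongrHom.toMonoidHom.comp (torsorPerm _ G2))
  let _ : MulAction (Coprod G1 G2) X := MulAction.compHom X ρ
  have he1 : ∀ g v h, (Coprod.inl g : Coprod G1 G2) • (Equiv.refl X) (v, h) =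
      Equiv.refl X (v, g * h) := by
    intro g v h
    change ρ (Coprod.inl g) (v, h) = _
    rw [Coprod.lift_apply_inl]
    rfl
  have he2 : ∀ g v h, (Coprod.inr g : Coprod G1 G2) • θ.symm (v, h) = θ.symm (v, g * h) := by
    intro g v h
    change ρ (Coprod.inr g) (θ.symm (v, h)) = _
    rw [Coprod.lift_apply_inr]
    change θ.symm (torsorPerm _ G2 g (θ (θ.symm (v, h)))) = _
    rw [Equiv.apply_symm_apply]
    rfl
  let ℓ : X → Option L := torsorLabel (c ∘ Sum.inl)
  have hℓ1 : ∀ p, ℓ (Equiv.refl X p) = torsorLabel (c ∘ Sum.inl) p := fun p => rfl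
  have hℓ2 : ∀ p, ℓ (θ.symm p) = torsorLabel (c ∘ Sum.inr) p := fun p => by
    have := hθ (θ.symm p)
    rw [Equiv.apply_symm_apply] at this
    exact this.symm
  have hfin : {x | ℓ x ≠ none}.Finite := by
    refine (Set.finite_range fun p : (Σ t, Fin ((c ∘ Sum.inl) t)) × G1 =>
      ((Sum.inl p.1, p.2) : X)).subset ?_
    rintro ⟨s | n, g⟩ h
    · exact ⟨(s, g), rfl⟩
    · exact absurd rfl h
  let Y := hfin.toFinset
  have hY : ∀ x, x ∈ Y ↔ ℓ x ≠ none := fun x => hfin.mem_toFinset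
  let Z := (Y₁ ×ˢ Y).filter fun z => z.1 ∈ fibre car (ℓ z.2)
  have hZ : ∀ x₁ x, (x₁, x) ∈ Z ↔ x₁ ∈ fibre car (ℓ x) := by
    intro x₁ x
    simp only [Z, Finset.mem_filter, Finset.mem_product, hY, and_iff_right_iff_imp]
    intro h
    match hx : ℓ x with
    | none => simp [hx, fibre] at h
    | some l =>
      rw [hx] at h
      exact ⟨hcar l h, by simp⟩
  have w1 := weight_of_torsor (car := car) he1 hℓ1 hY hZ
  have w2 := weight_of_torsor (car := car) he2 hℓ2 hY hZ
  refine ⟨X, inferInstance, Y, Z, ⟨⟨actsFreely_of_torsor he1, actsFreely_of_torsor he2⟩,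
    leafless_of_torsor he1 hℓ1 hc.2.1 hY, leafless_of_torsor he2 hℓ2 hc.2.2 hY,
    Finset.filter_subset _ _⟩, ?_, ?_⟩
  · rw [weight_sum, negEuler_eq_halfEuler_add, ← w1.1, ← w2.1]
    rfl
  · rw [weight_sum, negEuler_eq_halfEuler_add, ← w1.2, ← w2.2]
    rfl

end TypeVectors

omit [MulAction (Coprod G1 G2) X₁] in
theorem IsSystem.exists_label {Y₁ : Finset X₁} {X : Type} [MulAction (Coprod G1 G2) X]
    {Y : Finset X} {Z : Finset (X₁ × X)} (h : IsSystem G1 G2 Y₁ Y Z) :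
    ∃ ℓ : X → Option Y₁.powerset, (∀ x, x ∈ Y ↔ ℓ x ≠ none) ∧
      ∀ x₁ x, (x₁, x) ∈ Z ↔ x₁ ∈ fibre (fun l : Y₁.powerset => l.1) (ℓ x) := by
  refine ⟨fun x => if x ∈ Y then
    some ⟨Y₁.filter fun x₁ => (x₁, x) ∈ Z, Finset.mem_powerset.2 (Finset.filter_subset _ _)⟩
    else none, fun x => by simp, fun x₁ x => ?_⟩
  constructor
  · intro hz
    have := Finset.mem_product.1 (h.subset hz)
    simp [fibre, this.2, this.1, hz]
  · intro hx
    dsimp only at hx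
    split_ifs at hx with hxY
    · exact (Finset.mem_filter.1 hx).2
    · simp [fibre] at hx

/-- Among the systems over a finite set, the ratio of the negated Euler characteristics attains
its maximum. -/
theorem exists_optimal_system [Finite G1] [Finite G2] (Y₁ : Finset X₁)
    (hne : ∃ (X : Type) (_ : MulAction (Coprod G1 G2) X) (Y : Finset X) (Z : Finset (X₁ × X)),
      IsSystem G1 G2 Y₁ Y Z ∧ 0 < nEuler G1 G2 Y) :
    ∃ (X : Type) (_ : MulAction (Coprod G1 G2) X) (Y : Finset X) (Z : Finset (X₁ × X)),
      IsSystem G1 G2 Y₁ Y Z ∧ 0 < nEuler G1 G2 Y ∧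
      ∀ (X' : Type) [MulAction (Coprod G1 G2) X'] (Y' : Finset X') (Z' : Finset (X₁ × X')),
        IsSystem G1 G2 Y₁ Y' Z' →
          nEuler G1 G2 Z' * nEuler G1 G2 Y ≤ nEuler G1 G2 Z * nEuler G1 G2 Y' := by
  have := Fintype.ofFinite G1
  have := Fintype.ofFinite G2
  obtain ⟨X, _, Y, Z, h, hpos⟩ := hne
  obtain ⟨ℓ, hY, hZ⟩ := h.exists_label
  obtain ⟨c, hc, hcY, -⟩ := exists_typeVector h hY hZ
  obtain ⟨d, hd, hdpos, hmax⟩ := exists_maximal_ratio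
    (numWeight G1 G2 fun l : Y₁.powerset => l.1) (denWeight G1 G2 Y₁.powerset)
    (typeVectors G1 G2 Y₁.powerset) (fun x hx y hy hxy => sub_mem_typeVectors hx hy hxy)
    (fun x hx => Finset.sum_nonneg fun i _ => denWeight_nonneg hx i)
    (fun x hx => numWeight_nonpos hx) ⟨c, hc, by rw [hcY]; exact_mod_cast hpos⟩
  obtain ⟨X', _, Y', Z', h', hY', hZ'⟩ :=
    exists_system_of_typeVector (fun l : Y₁.powerset => Finset.mem_powerset.1 l.2) hd
  refine ⟨X', inferInstance, Y', Z', h', by rw [hY'] at hdpos; exact_mod_cast hdpos, ?_⟩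
  intro W _ Y'' Z'' h''
  obtain ⟨ℓ, hY, hZ⟩ := h''.exists_label
  obtain ⟨e, he, heY, heZ⟩ := exists_typeVector h'' hY hZ
  have := hmax e he
  rw [heY, heZ, hY', hZ'] at this
  exact_mod_cast this

end Systems

section Components

open scoped Classical

variable {F G G' X : Type} [Group F] [Group G] [Group G'] [MulAction F X] {j : G →* F}
  {j' : G' →* F}

theorem negEuler_eq_add {Z A B : Finset X} (hZ : ∀ z, z ∈ Z ↔ z ∈ A ∨ z ∈ B)
    (h : ∀ z ∈ A, ∀ z' ∈ B, ∀ g, j g • z ≠ z') (h' : ∀ z ∈ A, ∀ z' ∈ B, ∀ g, j' g • z ≠ z') :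
    negEuler j j' Z = negEuler j j' A + negEuler j j' B := by
  rw [← negEuler_union h h']
  congr 1
  ext z
  rw [hZ, Finset.mem_union]

theorem exists_negEuler_eq {W : Type} [MulAction F W] {Z : Finset X} (φ : X → W)
    (h : ∀ z ∈ Z, ∀ z' ∈ Z, ∀ g, j g • z = z' ↔ j g • φ z = φ z')
    (h' : ∀ z ∈ Z, ∀ z' ∈ Z, ∀ g, j' g • z = z' ↔ j' g • φ z = φ z') :
    ∃ V : Finset W, negEuler j j' V = negEuler j j' Z :=
  ⟨_, negEuler_image h h'⟩

theorem exists_spans_component (hj : ActsFreely j X) (hj' : ActsFreely j' X) {Y : Finset X} {x : X}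
    (hx : x ∈ Y) :
    ∃ Y₀ ⊆ Y, (∃ p S, Spans j j' x Y₀ p S) ∧ (∀ y ∈ Y₀, ∀ g, j g • y ∈ Y → j g • y ∈ Y₀) ∧
      ∀ y ∈ Y₀, ∀ g, j' g • y ∈ Y → j' g • y ∈ Y₀ := by
  obtain ⟨Y₀, hY₀, hmax⟩ := Finset.exists_max_image
    (Y.powerset.filter fun Y₀ => ∃ p S, Spans j j' x Y₀ p S) Finset.card
    ⟨{x}, Finset.mem_filter.2 ⟨Finset.mem_powerset.2 (Finset.singleton_subset_iff.2 hx),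
      _, _, Spans.singleton hj hj' x⟩⟩
  obtain ⟨hsub, p, S, h⟩ := Finset.mem_filter.1 hY₀
  rw [Finset.mem_powerset] at hsub
  have hins : ∀ y ∈ Y, (∃ p S, Spans j j' x (insert y Y₀) p S) → y ∈ Y₀ := by
    intro y hy hS
    by_contra hn
    have := hmax _ (Finset.mem_filter.2
      ⟨Finset.mem_powerset.2 (Finset.insert_subset hy hsub), hS⟩)
    rw [Finset.card_insert_of_notMem hn] at this
    lia
  refine ⟨Y₀, hsub, ⟨p, S, h⟩, fun y hy g hg => ?_, fun y hy g hg => ?_⟩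
  · by_contra hn
    obtain ⟨p', S', h', -⟩ := h.extend hj hj' hy hn
    exact hn (hins _ hg ⟨p', S', h'⟩)
  · by_contra hn
    obtain ⟨p', S', h', -⟩ := h.symm.extend hj' hj hy hn
    exact hn (hins _ hg ⟨p', S', h'.symm⟩)

theorem closed_sdiff {Y Y₀ : Finset X} (h : ∀ y ∈ Y₀, ∀ g, j g • y ∈ Y → j g • y ∈ Y₀) :
    ∀ y ∈ Y \ Y₀, ∀ g, j g • y ∈ Y → j g • y ∈ Y \ Y₀ := by
  intro y hy g hg
  rw [Finset.mem_sdiff] at hy ⊢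
  refine ⟨hg, fun hn => hy.2 ?_⟩
  have := h _ hn g⁻¹
  rw [map_inv, inv_smul_smul] at this
  exact this hy.1

variable {G1 G2 X₁ : Type} [Group G1] [Group G2] [MulAction (Coprod G1 G2) X₁]
  [MulAction (Coprod G1 G2) X]

omit [MulAction (Coprod G1 G2) X₁] in
theorem IsSystem.restrict {Y₁ : Finset X₁} {Y Y₀ : Finset X} {Z : Finset (X₁ × X)}
    (h : IsSystem G1 G2 Y₁ Y Z) (hsub : Y₀ ⊆ Y)
    (hl : ∀ y ∈ Y₀, ∀ g : G1, (Coprod.inl g : Coprod G1 G2) • y ∈ Y →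
      (Coprod.inl g : Coprod G1 G2) • y ∈ Y₀)
    (hr : ∀ y ∈ Y₀, ∀ g : G2, (Coprod.inr g : Coprod G1 G2) • y ∈ Y →
      (Coprod.inr g : Coprod G1 G2) • y ∈ Y₀) :
    IsSystem G1 G2 Y₁ Y₀ (Z.filter (·.2 ∈ Y₀)) where
  free := h.free
  left y hy := (h.left y (hsub hy)).imp fun g hg => ⟨hg.1, hl y hy g hg.2⟩
  right y hy := (h.right y (hsub hy)).imp fun g hg => ⟨hg.1, hr y hy g hg.2⟩
  subset z hz := by
    obtain ⟨hz, hz'⟩ := Finset.mem_filter.1 hz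
    exact Finset.mem_product.2 ⟨(Finset.mem_product.1 (h.subset hz)).1, hz'⟩

/-- An optimal system contains an optimal system that is connected. -/
theorem IsSystem.exists_spans {Y₁ : Finset X₁} {Y : Finset X} {Z : Finset (X₁ × X)}
    (h : IsSystem G1 G2 Y₁ Y Z) (hpos : 0 < nEuler G1 G2 Y)
    (hopt : ∀ (Y' : Finset X) (Z' : Finset (X₁ × X)), IsSystem G1 G2 Y₁ Y' Z' →
      nEuler G1 G2 Z' * nEuler G1 G2 Y ≤ nEuler G1 G2 Z * nEuler G1 G2 Y') :
    ∃ (Y' : Finset X) (Z' : Finset (X₁ × X)), IsSystem G1 G2 Y₁ Y' Z' ∧ 0 < nEuler G1 G2 Y' ∧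
      nEuler G1 G2 Z' * nEuler G1 G2 Y = nEuler G1 G2 Z * nEuler G1 G2 Y' ∧
      ∃ x p S, Spans (Coprod.inl : G1 →* Coprod G1 G2) Coprod.inr x Y' p S := by
  induction hn : Y.card using Nat.strong_induction_on generalizing Y Z with
  | h n ih =>
  obtain ⟨x, hx⟩ : Y.Nonempty := by
    rw [Finset.nonempty_iff_ne_empty]
    rintro rfl
    simp at hpos
  obtain ⟨Y₀, hsub, hspan, hl, hr⟩ := exists_spans_component h.free.1 h.free.2 hx
  have h0 := h.restrict hsub hl hr
  have h1 := h.restrict Finset.sdiff_subset (closed_sdiff hl) (closed_sdiff hr)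
  have hY : nEuler G1 G2 Y = nEuler G1 G2 Y₀ + nEuler G1 G2 (Y \ Y₀) := by
    refine negEuler_eq_add (fun z => ?_) (fun z hz z' hz' g e => ?_) (fun z hz z' hz' g e => ?_)
    · have := @hsub z
      rw [Finset.mem_sdiff]
      tauto
    · rw [Finset.mem_sdiff, ← e] at hz'
      exact hz'.2 (hl z hz g hz'.1)
    · rw [Finset.mem_sdiff, ← e] at hz'
      exact hz'.2 (hr z hz g hz'.1)
  have hZ : nEuler G1 G2 Z =
      nEuler G1 G2 (Z.filter (·.2 ∈ Y₀)) + nEuler G1 G2 (Z.filter (·.2 ∈ Y \ Y₀)) := by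
    refine negEuler_eq_add (fun z => ?_) (fun z hz z' hz' g e => ?_) (fun z hz z' hz' g e => ?_)
    · have hm : z ∈ Z → z.2 ∈ Y := fun hz => (Finset.mem_product.1 (h.subset hz)).2
      simp only [Finset.mem_filter, Finset.mem_sdiff]
      tauto
    · obtain ⟨-, hz⟩ := Finset.mem_filter.1 hz
      obtain ⟨-, hz'⟩ := Finset.mem_filter.1 hz'
      rw [Finset.mem_sdiff, ← e] at hz'
      exact hz'.2 (hl _ hz g hz'.1)
    · obtain ⟨-, hz⟩ := Finset.mem_filter.1 hz
      obtain ⟨-, hz'⟩ := Finset.mem_filter.1 hz'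
      rw [Finset.mem_sdiff, ← e] at hz'
      exact hz'.2 (hr _ hz g hz'.1)
  have o0 := hopt _ _ h0
  have o1 := hopt _ _ h1
  have e0 : nEuler G1 G2 (Z.filter (·.2 ∈ Y₀)) * nEuler G1 G2 Y =
      nEuler G1 G2 Z * nEuler G1 G2 Y₀ := by
    rw [hY, hZ] at *
    linarith
  have e1 : nEuler G1 G2 (Z.filter (·.2 ∈ Y \ Y₀)) * nEuler G1 G2 Y =
      nEuler G1 G2 Z * nEuler G1 G2 (Y \ Y₀) := by
    rw [hY, hZ] at *
    linarith
  by_cases hp0 : 0 < nEuler G1 G2 Y₀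
  · exact ⟨Y₀, _, h0, hp0, e0, x, hspan⟩
  have hp1 : 0 < nEuler G1 G2 (Y \ Y₀) := by lia
  obtain ⟨p, S, hS⟩ := hspan
  have hlt : (Y \ Y₀).card < n := by
    rw [← hn]
    exact Finset.card_lt_card (Finset.sdiff_ssubset hsub ⟨x, hS.base⟩)
  have hopt1 : ∀ (Y' : Finset X) (Z' : Finset (X₁ × X)), IsSystem G1 G2 Y₁ Y' Z' →
      nEuler G1 G2 Z' * nEuler G1 G2 (Y \ Y₀) ≤
        nEuler G1 G2 (Z.filter (·.2 ∈ Y \ Y₀)) * nEuler G1 G2 Y' := by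
    refine fun Y' Z' h' => le_of_mul_le_mul_right ?_ hpos
    have := mul_le_mul_of_nonneg_right (hopt Y' Z' h') hp1.le
    linear_combination this - nEuler G1 G2 Y' * e1
  obtain ⟨Y', Z', h', hp', e', hsp⟩ := ih _ hlt h1 hp1 hopt1 rfl
  refine ⟨Y', Z', h', hp', mul_right_cancel₀ hp1.ne' ?_, hsp⟩
  linear_combination nEuler G1 G2 Y * e' + nEuler G1 G2 Y' * e1

end Components

section Realization

open scoped Classical

variable {G1 G2 X : Type} [Group G1] [Group G2] [MulAction (Coprod G1 G2) X]

/-- A connected system with positive negated Euler characteristic over a core of `H1` comes from a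
factor-free subgroup. -/
theorem exists_subgroup_of_spans {H1 : Subgroup (Coprod G1 G2)} (h1 : FactorFree2 H1)
    {Y₁ : Finset (Coprod G1 G2 ⧸ H1)}
    (hY₁ : IsCore (Coprod.inl : G1 →* Coprod G1 G2) Coprod.inr Y₁)
    {Y : Finset X} {Z : Finset ((Coprod G1 G2 ⧸ H1) × X)} (h : IsSystem G1 G2 Y₁ Y Z)
    (hpos : 0 < nEuler G1 G2 Y) {x : X} {p : X → Coprod G1 G2} {S : Finset (Coprod G1 G2)}
    (hS : Spans (Coprod.inl : G1 →* Coprod G1 G2) Coprod.inr x Y p S) :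
    ∃ H2 : Subgroup (Coprod G1 G2), H2.FG ∧ FactorFree2 H2 ∧ Noncyclic H2 ∧
      (rrk H2 : ℤ) = nEuler G1 G2 Y ∧ nEuler G1 G2 Z ≤ rrkInter H1 H2 := by
  let H2 := Subgroup.closure (S : Set (Coprod G1 G2))
  have hstab : H2 ≤ MulAction.stabilizer (Coprod G1 G2) x := (Subgroup.closure_le _).2 hS.stab
  have hfg : H2.FG := ⟨S, rfl⟩
  have hff : FactorFree2 H2 := factorFree2_of_le_stabilizer h.free hstab
  let s : X → Coprod G1 G2 ⧸ H2 := fun y => (p y : Coprod G1 G2 ⧸ H2)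
  have hs : ∀ (f : Coprod G1 G2) (y y' : X), f • s y = s y' ↔ (p y')⁻¹ * f * p y ∈ H2 := by
    intro f y y'
    rw [eq_comm, mul_assoc]
    exact QuotientGroup.eq
  have hs' : ∀ f : Coprod G1 G2, ∀ y ∈ Y, ∀ y' ∈ Y, f • s y = s y' → f • y = y' := by
    intro f y hy y' hy' e
    have h1 : ((p y')⁻¹ * f * p y) • x = x := hstab ((hs f y y').1 e)
    rw [mul_smul, hS.smul_base y hy, mul_smul, inv_smul_eq_iff, hS.smul_base y' hy'] at h1
    exact h1
  have hl : ∀ y ∈ Y, ∀ y' ∈ Y, ∀ g : G1, (Coprod.inl g : Coprod G1 G2) • y = y' ↔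
      (Coprod.inl g : Coprod G1 G2) • s y = s y' := by
    refine fun y hy y' hy' g => ⟨?_, hs' _ y hy y' hy'⟩
    rintro rfl
    exact (hs _ _ _).2 (hS.left y hy g hy')
  have hr : ∀ y ∈ Y, ∀ y' ∈ Y, ∀ g : G2, (Coprod.inr g : Coprod G1 G2) • y = y' ↔
      (Coprod.inr g : Coprod G1 G2) • s y = s y' := by
    refine fun y hy y' hy' g => ⟨?_, hs' _ y hy y' hy'⟩
    rintro rfl
    exact (hs _ _ _).2 (hS.right y hy g hy')
  obtain ⟨V, hV⟩ : ∃ V : Finset (Coprod G1 G2 ⧸ H2), nEuler G1 G2 V = nEuler G1 G2 Y :=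
    exists_negEuler_eq s hl hr
  obtain ⟨V', hV'⟩ : ∃ V' : Finset ((Coprod G1 G2 ⧸ H1) × (Coprod G1 G2 ⧸ H2)),
      nEuler G1 G2 V' = nEuler G1 G2 Z := by
    have hZY : ∀ z ∈ Z, z.2 ∈ Y := fun z hz => (Finset.mem_product.1 (h.subset hz)).2
    refine exists_negEuler_eq (Prod.map id s) (fun z hz z' hz' g => ?_) (fun z hz z' hz' g => ?_)
    · rw [Prod.ext_iff, Prod.ext_iff]
      exact and_congr Iff.rfl (hl _ (hZY z hz) _ (hZY z' hz') g)
    · rw [Prod.ext_iff, Prod.ext_iff]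
      exact and_congr Iff.rfl (hr _ (hZY z hz) _ (hZY z' hz') g)
  have hle : (rk H2 : ℤ) ≤ 1 + nEuler G1 G2 Y :=
    le_trans (by exact_mod_cast rk_le_card rfl) hS.card_le
  have hge : nEuler G1 G2 Y ≤ rrk H2 := by
    have hst := MulAction.stabilizer_quotient H2
    have := nEuler_le_rrk ((1 : Coprod G1 G2) : Coprod G1 G2 ⧸ H2) (hst.symm ▸ hfg) V
    rwa [hst, hV] at this
  have hrr : rrk H2 = rk H2 - 1 := rfl
  obtain ⟨Y₂, -, -, hY₂⟩ := exists_core_quotient hff hfg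
  exact ⟨H2, hfg, hff, noncyclic_of_two_le_rk (by lia), by lia,
    hV' ▸ (rrkInter_spec h1 hY₁ hY₂).2 _⟩

end Realization

section LeaflessCores

open scoped Classical

theorem IsCore.erase {F G G' X : Type} [Group F] [Group G] [Group G'] [MulAction F X] {j : G →* F}
    {j' : G' →* F} {Y : Finset X} (h : IsCore j j' Y) {y : X}
    (leaf : ∀ g, j' g • y ∈ Y → g = 1) : IsCore j j' (Y.erase y) := by
  intro W _ φ hφ Z
  refine (h W φ hφ Z).trans ((negEuler_le_sdiff
    (P := (Z.filter (φ · ∈ Y)).filter (φ · = y)) (Finset.filter_subset _ _) ?_).trans_eq ?_)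
  · intro p hp g hg
    rw [Finset.mem_filter] at hp hg
    rw [hφ, hp.2] at hg
    rw [leaf g hg.2, map_one, one_smul]
  · congr 1
    ext z
    simp only [Finset.mem_filter, Finset.mem_sdiff, Finset.mem_erase]
    tauto

theorem IsCore.symm {F G G' X : Type} [Group F] [Group G] [Group G'] [MulAction F X] {j : G →* F}
    {j' : G' →* F} {Y : Finset X} (h : IsCore j j' Y) : IsCore j' j Y := by
  intro W _ φ hφ Z
  rw [negEuler_comm j' j, negEuler_comm j' j]
  exact h W φ hφ Z

theorem IsCore.le_erase {F G G' X : Type} [Group F] [Group G] [Group G'] [MulAction F X]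
    {j : G →* F} {j' : G' →* F} {Y : Finset X} {y : X} (h : IsCore j j' (Y.erase y)) :
    negEuler j j' Y ≤ negEuler j j' (Y.erase y) := by
  refine (h X id (fun _ _ => rfl) Y).trans_eq (congrArg _ ?_)
  ext z
  simp only [Finset.mem_filter, Finset.mem_erase, id]
  tauto

theorem IsCore.exists_leafless {F G G' X : Type} [Group F] [Group G] [Group G'] [MulAction F X]
    {j : G →* F} {j' : G' →* F} {Y : Finset X} (h : IsCore j j' Y) :
    ∃ Y' : Finset X, negEuler j j' Y ≤ negEuler j j' Y' ∧ IsCore j j' Y' ∧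
      (∀ y ∈ Y', ∃ g, g ≠ 1 ∧ j g • y ∈ Y') ∧ ∀ y ∈ Y', ∃ g, g ≠ 1 ∧ j' g • y ∈ Y' := by
  have hex : ∃ n, ∃ Y' : Finset X, Y'.card = n ∧ negEuler j j' Y ≤ negEuler j j' Y' ∧
      IsCore j j' Y' := ⟨_, Y, rfl, le_rfl, h⟩
  obtain ⟨Y', hn, hle, hc⟩ := Nat.find_spec hex
  have hmin : ∀ y ∈ Y', ¬ IsCore j j' (Y'.erase y) := by
    intro y hy hcore
    refine Nat.find_min hex ?_ ⟨Y'.erase y, rfl, hle.trans hcore.le_erase, hcore⟩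
    rw [← hn]
    exact Finset.card_erase_lt_of_mem hy
  refine ⟨Y', hle, hc, fun y hy => ?_, fun y hy => ?_⟩
  · by_contra! hn
    exact hmin y hy (hc.symm.erase fun g hg => by_contra fun h => hn g h hg).symm
  · by_contra! hn
    exact hmin y hy (hc.erase fun g hg => by_contra fun h => hn g h hg)

variable {G1 G2 : Type} [Group G1] [Group G2]

/-- A noncyclic finitely generated factor-free subgroup has a core without leaves. -/
theorem exists_leafless_core {H : Subgroup (Coprod G1 G2)} (hfg : H.FG) (hH : FactorFree2 H)
    (hnc : Noncyclic H) :
    ∃ Y : Finset (Coprod G1 G2 ⧸ H), nEuler G1 G2 Y = rrk H ∧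
      IsCore (Coprod.inl : G1 →* Coprod G1 G2) Coprod.inr Y ∧
      (∀ y ∈ Y, ∃ g : G1, g ≠ 1 ∧ (Coprod.inl g : Coprod G1 G2) • y ∈ Y) ∧
      ∀ y ∈ Y, ∃ g : G2, g ≠ 1 ∧ (Coprod.inr g : Coprod G1 G2) • y ∈ Y := by
  have h2 := two_le_rk hfg hnc
  have hrr : rrk H = rk H - 1 := rfl
  obtain ⟨Y₀, -, hY₀, hc₀⟩ := exists_core_quotient hH hfg
  obtain ⟨Y, hle, hc, hl, hr⟩ := hc₀.exists_leafless
  have hst := MulAction.stabilizer_quotient H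
  have hge := nEuler_le_rrk ((1 : Coprod G1 G2) : Coprod G1 G2 ⧸ H) (hst.symm ▸ hfg) Y
  rw [hst] at hge
  exact ⟨Y, by lia, hc, hl, hr⟩

/-- The ratios defining the WN-coefficient are ratios of systems. -/
theorem exists_isSystem {H1 H2 : Subgroup (Coprod G1 G2)} (h1 : FactorFree2 H1)
    {Y₁ : Finset (Coprod G1 G2 ⧸ H1)}
    (hY₁ : IsCore (Coprod.inl : G1 →* Coprod G1 G2) Coprod.inr Y₁) (hfg : H2.FG)
    (hff : FactorFree2 H2) (hnc : Noncyclic H2) :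
    ∃ (Y : Finset (Coprod G1 G2 ⧸ H2)) (Z : Finset ((Coprod G1 G2 ⧸ H1) × (Coprod G1 G2 ⧸ H2))),
      IsSystem G1 G2 Y₁ Y Z ∧ nEuler G1 G2 Y = rrk H2 ∧ nEuler G1 G2 Z = rrkInter H1 H2 := by
  obtain ⟨Y, hY, hc, hl, hr⟩ := exists_leafless_core hfg hff hnc
  obtain ⟨⟨Z, hZs, hZ⟩, -⟩ := rrkInter_spec h1 hY₁ hc
  exact ⟨Y, Z, ⟨hff.factorsFree, hl, hr, hZs⟩, hY, hZ⟩

theorem rrk_pos {F : Type} [Group F] {H : Subgroup F} (hfg : H.FG) (hnc : Noncyclic H) :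
    0 < rrk H := by
  have := two_le_rk hfg hnc
  unfold rrk
  lia

/-- The ratios `r̄(H1, H2) / r̄(H2)` have a maximum. -/
theorem exists_maximal_subgroup [Finite G1] [Finite G2] {H1 : Subgroup (Coprod G1 G2)}
    (h1fg : H1.FG) (h1ff : FactorFree2 H1) (h1nc : Noncyclic H1) :
    ∃ H : Subgroup (Coprod G1 G2), H.FG ∧ FactorFree2 H ∧ Noncyclic H ∧
      ∀ H2 : Subgroup (Coprod G1 G2), H2.FG → FactorFree2 H2 → Noncyclic H2 →
        rrkInter H1 H2 * rrk H ≤ rrkInter H1 H * rrk H2 := by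
  obtain ⟨Y₁, -, hc₁, -⟩ := exists_leafless_core h1fg h1ff h1nc
  have hne : ∃ (X : Type) (_ : MulAction (Coprod G1 G2) X) (Y : Finset X)
      (Z : Finset ((Coprod G1 G2 ⧸ H1) × X)), IsSystem G1 G2 Y₁ Y Z ∧ 0 < nEuler G1 G2 Y := by
    obtain ⟨Y, Z, h, hY, -⟩ := exists_isSystem h1ff hc₁ h1fg h1ff h1nc
    exact ⟨_, _, Y, Z, h, hY ▸ by exact_mod_cast rrk_pos h1fg h1nc⟩
  obtain ⟨X, _, Y, Z, h, hpos, hopt⟩ := exists_optimal_system Y₁ hne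
  obtain ⟨Y', Z', h', hpos', e, x, p, S, hS⟩ := h.exists_spans hpos fun Y' Z' => hopt X Y' Z'
  obtain ⟨H, hfg, hff, hnc, hrk, hle⟩ := exists_subgroup_of_spans h1ff hc₁ h' hpos' hS
  refine ⟨H, hfg, hff, hnc, fun H2 h2fg h2ff h2nc => ?_⟩
  obtain ⟨Y₂, Z₂, h₂, hY₂, hZ₂⟩ := exists_isSystem h1ff hc₁ h2fg h2ff h2nc
  have key := hopt _ Y₂ Z₂ h₂
  have key' : nEuler G1 G2 Z₂ * nEuler G1 G2 Y' ≤ nEuler G1 G2 Z' * nEuler G1 G2 Y₂ := by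
    refine le_of_mul_le_mul_right ?_ hpos
    have := mul_le_mul_of_nonneg_right key hpos'.le
    linear_combination this - nEuler G1 G2 Y₂ * e
  rw [hY₂, hZ₂, ← hrk] at key'
  exact_mod_cast key'.trans (mul_le_mul_of_nonneg_right hle (by positivity))

end LeaflessCores

/-- If `G1, G2` are nontrivial finite groups and `H1` is a finitely generated factor-free
noncyclic subgroup of `F = G1 ∗ G2`, then the WN-coefficient
`σ(H1) = sup { r̄(H1,H2)/(r̄(H1)·r̄(H2)) }` is a finite rational number. -/
theorem statement0 {G1 G2 : Type} [Group G1] [Group G2]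
    [Finite G1] [Finite G2] [Nontrivial G1] [Nontrivial G2]
    (H1 : Subgroup (Coprod G1 G2)) (h1fg : H1.FG) (h1ff : FactorFree2 H1)
    (h1nc : Noncyclic H1) :
    BddAbove (wnSet H1) ∧ ∃ q : ℚ, sSup (wnSet H1) = (q : ℝ) := by
  obtain ⟨H, hfg, hff, hnc, hmax⟩ := exists_maximal_subgroup h1fg h1ff h1nc
  have hgr : IsGreatest (wnSet H1) ((rrkInter H1 H : ℝ) / ((rrk H1 : ℝ) * (rrk H : ℝ))) := by
    refine ⟨⟨H, hfg, hff, hnc, rfl⟩, ?_⟩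
    rintro _ ⟨H2, h2fg, h2ff, h2nc, rfl⟩
    have p1 : (0 : ℝ) < rrk H1 := by exact_mod_cast rrk_pos h1fg h1nc
    have p2 : (0 : ℝ) < rrk H2 := by exact_mod_cast rrk_pos h2fg h2nc
    have p3 : (0 : ℝ) < rrk H := by exact_mod_cast rrk_pos hfg hnc
    have key : (rrkInter H1 H2 : ℝ) * rrk H ≤ rrkInter H1 H * rrk H2 := by
      exact_mod_cast hmax H2 h2fg h2ff h2nc
    rw [div_le_div_iff₀ (by positivity) (by positivity)]
    linear_combination (rrk H1 : ℝ) * key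
  refine ⟨hgr.bddAbove, (rrkInter H1 H : ℚ) / ((rrk H1 : ℚ) * (rrk H : ℚ)), ?_⟩
  rw [hgr.csSup_eq]
  push_cast
  rfl
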